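/- For every ε > 0 there exist constants C_ε > 0 and c > 0 such that the following holds. Let p be a prime and A ⊆ F_p a nonempty finite set with |A²−A²|·|A−A|·|A| ≤ c·p². Then X := Σ_{w ∈ A²−A²} #{(u,v) ∈ P_w × P_w : u−v ∈ P} satisfies X ≤ C_ε·p^{ε}·( M^{15/4}·K^{17/4}·|A|^{7/4} + M^{7/2}·K^{7/2}·|A|^{3/2} ), where M := |A−A|/|A| and K := |A²−A²|/|A|. -/

import Mathlib

open Finset Pointwise

namespace FpSumProd

/-- `A² = {a² : a ∈ A}`. -/
def sqSet {p : ℕ} (A : Finset (ZMod p)) : Finset (ZMod p) := A.image fun a => a ^ 2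

/-- `A² - A² = {a² - b² : a, b ∈ A}` (here `A - B` denotes the pointwise difference set). -/
def sqDiff {p : ℕ} (A : Finset (ZMod p)) : Finset (ZMod p) := sqSet A - sqSet A

/-- `r_{A²-A²}(x)`: the number of pairs `(y, z) ∈ A² × A²` with `y - z = x`. -/
def rep {p : ℕ} (A : Finset (ZMod p)) (x : ZMod p) : ℕ :=
  ((sqSet A ×ˢ sqSet A).filter fun q => q.1 - q.2 = x).card

/-- `P = {x ∈ A²-A² : r_{A²-A²}(x) ≥ |A|²/(2·|A²-A²|)}`, i.e. `r_{A²-A²}(x) ≥ |A|/(2K)`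
with `K = |A²-A²|/|A|`. -/
noncomputable def popular {p : ℕ} (A : Finset (ZMod p)) : Finset (ZMod p) :=
  (sqDiff A).filter fun x =>
    (A.card : ℝ) ^ 2 / (2 * ((sqDiff A).card : ℝ)) ≤ (rep A x : ℝ)

/-- `P_w = (A²-A²) ∩ (P - w)` where `P - w = {x - w : x ∈ P}`. -/
noncomputable def Pw {p : ℕ} (A : Finset (ZMod p)) (w : ZMod p) : Finset (ZMod p) :=
  sqDiff A ∩ ((popular A).image fun x => x - w)

/-- `T_w = #{(u, v) ∈ P_w × P_w : u - v ∈ P}`. -/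
noncomputable def Tw {p : ℕ} (A : Finset (ZMod p)) (w : ZMod p) : ℕ :=
  ((Pw A w ×ˢ Pw A w).filter fun q => q.1 - q.2 ∈ popular A).card

/-- `X = Σ_{w ∈ A²-A²} #{(u, v) ∈ P_w × P_w : u - v ∈ P}`. -/
noncomputable def Xsum {p : ℕ} (A : Finset (ZMod p)) : ℕ :=
  ∑ w ∈ sqDiff A, Tw A w

/-- `E₄(A²)`: the number of `8`-tuples `(x₁,x₂,x₃,x₄,y₁,y₂,y₃,y₄) ∈ (A²)⁸` with
`x₁ - y₁ = x₂ - y₂ = x₃ - y₃ = x₄ - y₄`. -/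
noncomputable def E4 {p : ℕ} (A : Finset (ZMod p)) : ℕ :=
  Set.ncard {v : Fin 4 → ZMod p × ZMod p |
    (∀ i, (v i).1 ∈ sqSet A ∧ (v i).2 ∈ sqSet A) ∧
    ∀ i, (v i).1 - (v i).2 = (v 0).1 - (v 0).2}

section Elimination
open MvPolynomial
variable {K : Type*} [Field K]

lemma totalDegree_resultant_le {σ : Type*} (f g : Polynomial (MvPolynomial σ K)) (m n d e : ℕ)
    (hf : ∀ i, (f.coeff i).totalDegree ≤ d) (hg : ∀ i, (g.coeff i).totalDegree ≤ e) :
    (Polynomial.resultant f g m n).totalDegree ≤ m * e + n * d := by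
  unfold Polynomial.resultant
  rw [Matrix.det_apply]
  refine totalDegree_finsetSum_le fun τ _ => ?_
  refine (totalDegree_smul_le _ _).trans ?_
  refine (totalDegree_finsetProd _ _).trans ?_
  rw [Fin.sum_univ_add]
  refine add_le_add ((Finset.sum_le_card_nsmul _ _ e fun i _ => ?_).trans (by simp))
    ((Finset.sum_le_card_nsmul _ _ d fun i _ => ?_).trans (by simp))
  · simp only [Polynomial.sylvester, Matrix.of_apply, Fin.addCases_left]
    split_ifs
    · exact hg _
    · simp
  · simp only [Polynomial.sylvester, Matrix.of_apply, Fin.addCases_right]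
    split_ifs
    · exact hf _
    · simp

lemma finSuccEquiv_rename_succ {n : ℕ} (R : MvPolynomial (Fin n) K) :
    finSuccEquiv K n (rename Fin.succ R) = Polynomial.C R := by
  have : (finSuccEquiv K n).toAlgHom.comp (rename Fin.succ) =
      IsScalarTower.toAlgHom K (MvPolynomial (Fin n) K) _ :=
    MvPolynomial.algHom_ext fun i => by simp [finSuccEquiv_X_succ]
  exact congrArg (fun φ => φ R) this

/-- Eliminating the variable `0` from an irreducible polynomial `Q` and a polynomial `H` that it
does not divide. -/
lemma exists_eliminant {n : ℕ} {Q H : MvPolynomial (Fin (n + 1)) K} (hQ : Irreducible Q)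
    (hQ0 : (finSuccEquiv K n Q).natDegree ≠ 0) (hQH : ¬ Q ∣ H) :
    ∃ G : MvPolynomial (Fin n) K, G ≠ 0 ∧
      G.totalDegree ≤ 2 * (Q.totalDegree * H.totalDegree) ∧
      ∃ u v, rename Fin.succ G = Q * u + H * v := by
  set f := finSuccEquiv K n Q with hf
  set g := finSuccEquiv K n H with hg
  have hfirr : Irreducible f := (MulEquiv.irreducible_iff (finSuccEquiv K n)).2 hQ
  have hprim : f.IsPrimitive := hfirr.isPrimitive hQ0
  let F := FractionRing (MvPolynomial (Fin n) K)
  have hinj : Function.Injective (algebraMap (MvPolynomial (Fin n) K) F) :=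
    IsFractionRing.injective _ _
  have hfg : ¬ f ∣ g := fun h => hQH ((map_dvd_iff (finSuccEquiv K n)).1 h)
  have hcop : IsCoprime (f.map (algebraMap _ F)) (g.map (algebraMap _ F)) := by
    refine (EuclideanDomain.dvd_or_coprime _ _
      (hprim.irreducible_iff_irreducible_map_fraction_map.1 hfirr)).resolve_left fun h => ?_
    exact hfg (hprim.dvd_of_fraction_map_dvd_fraction_map h)
  have hres : Polynomial.resultant f g ≠ 0 := by
    intro h0
    have h1 : Polynomial.resultant (f.map (algebraMap _ F)) (g.map (algebraMap _ F)) = 0 := by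
      have := Polynomial.resultant_map_map f g f.natDegree g.natDegree (algebraMap _ F)
      rw [h0, map_zero] at this
      rwa [Polynomial.natDegree_map_eq_of_injective hinj,
        Polynomial.natDegree_map_eq_of_injective hinj]
    exact (Polynomial.resultant_eq_zero_iff.1 h1).2 hcop
  have hcoeff : ∀ (P : MvPolynomial (Fin (n + 1)) K) (i : ℕ),
      ((finSuccEquiv K n P).coeff i).totalDegree ≤ P.totalDegree := by
    intro P i
    by_cases h : (finSuccEquiv K n P).coeff i = 0
    · simp [h]
    · exact (Nat.le_add_right _ _).trans (totalDegree_coeff_finSuccEquiv_add_le P i h)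
  obtain ⟨u, v, -, -, huv⟩ := Polynomial.exists_mul_add_mul_eq_C_resultant f g le_rfl
    (le_refl g.natDegree) (Or.inl hQ0)
  refine ⟨Polynomial.resultant f g, hres, ?_, (finSuccEquiv K n).symm u,
    (finSuccEquiv K n).symm v, ?_⟩
  · refine (totalDegree_resultant_le f g _ _ _ _ (hcoeff Q) (hcoeff H)).trans ?_
    have h1 : f.natDegree ≤ Q.totalDegree := by
      rw [hf, natDegree_finSuccEquiv]; exact degreeOf_le_totalDegree _ _
    have h2 : g.natDegree ≤ H.totalDegree := by
      rw [hg, natDegree_finSuccEquiv]; exact degreeOf_le_totalDegree _ _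
    nlinarith [Nat.mul_le_mul_right H.totalDegree h1, Nat.mul_le_mul_right Q.totalDegree h2]
  · apply (finSuccEquiv K n).injective
    simp only [map_add, map_mul, AlgEquiv.apply_symm_apply]
    rw [← hf, ← hg, huv]
    exact finSuccEquiv_rename_succ _

end Elimination

section Lines
open MvPolynomial
variable {K : Type*} [Field K]

/-- The point with parameter `z` on the line `l = (β, a, b)`, along which the coordinate `s` of the
base plane is constantly `β`, the other one is `z`, and the height is `a * z + b`. -/
def linePt (s : Fin 2) (l : K × K × K) (z : K) : Fin 3 → K :=
  Fin.cons (l.2.1 * z + l.2.2) fun i => if i = s then l.1 else z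

/-- Restriction of a polynomial to the line `l`. -/
noncomputable def lineRes (s : Fin 2) (l : K × K × K) : MvPolynomial (Fin 3) K →ₐ[K] Polynomial K :=
  aeval (Fin.cons (Polynomial.C l.2.1 * Polynomial.X + Polynomial.C l.2.2)
    fun i => if i = s then Polynomial.C l.1 else Polynomial.X)

/-- The lines `l` and `m`, from different families, meet. -/
def Meets (l m : K × K × K) : Prop := l.2.1 * m.1 + l.2.2 = m.2.1 * l.1 + m.2.2

lemma Meets.symm {l m : K × K × K} (h : Meets l m) : Meets m l := Eq.symm h

lemma eval_lineRes (s : Fin 2) (l : K × K × K) (z : K) (Q : MvPolynomial (Fin 3) K) :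
    (lineRes s l Q).eval z = eval (linePt s l z) Q := by
  have : (Polynomial.evalRingHom z).comp (lineRes s l).toRingHom = eval (linePt s l z) := by
    apply MvPolynomial.ringHom_ext
    · intro r; simp [lineRes]
    · intro i
      refine Fin.cases ?_ (fun j => ?_) i
      · simp [lineRes, linePt]
      · by_cases h : j = s <;> simp [lineRes, linePt, h]
  exact congrArg (fun φ => φ Q) this

lemma natDegree_lineRes_le (s : Fin 2) (l : K × K × K) (Q : MvPolynomial (Fin 3) K) :
    (lineRes s l Q).natDegree ≤ Q.totalDegree := by
  have := aeval_natDegree_le (n := 1) Q le_rfl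
    (Fin.cons (Polynomial.C l.2.1 * Polynomial.X + Polynomial.C l.2.2)
    fun i => if i = s then Polynomial.C l.1 else Polynomial.X : Fin 3 → Polynomial K) (by
      intro i
      refine Fin.cases ?_ (fun j => ?_) i
      · exact Polynomial.natDegree_linear_le
      · by_cases h : j = s <;> simp [h])
  simpa [lineRes] using this

lemma Meets.linePt_eq {s t : Fin 2} (hst : s ≠ t) {l m : K × K × K} (h : Meets l m) :
    linePt s l m.1 = linePt t m l.1 := by
  unfold linePt
  rw [show l.2.1 * m.1 + l.2.2 = m.2.1 * l.1 + m.2.2 from h]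
  congr 1
  funext i
  by_cases h1 : i = s
  · have : i ≠ t := h1 ▸ hst
    simp [h1, hst]
  · have : i = t := by omega
    subst this; simp [h1]

lemma card_le_of_vanish_on_lines [Infinite K] (s : Fin 2) {G : MvPolynomial (Fin 2) K} (hG : G ≠ 0)
    (L : Finset (K × K × K)) (hL : Set.InjOn Prod.fst (L : Set (K × K × K)))
    (h : ∀ l ∈ L, lineRes s l (rename Fin.succ G) = 0) : L.card ≤ G.totalDegree := by
  classical
  by_contra! hlt
  apply hG
  obtain ⟨Z, hZ⟩ := Infinite.exists_subset_card_eq K (G.totalDegree + 1)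
  refine eq_zero_of_eval_zero_at_prod_finset G
    (fun i => if i = s then L.image Prod.fst else Z) (fun i => ?_) (fun x hx => ?_)
  · refine (degreeOf_le_totalDegree _ _).trans_lt ?_
    split_ifs
    · rwa [Finset.card_image_of_injOn hL]
    · omega
  · have hs := hx s
    simp only [if_true, Finset.mem_image] at hs
    obtain ⟨l, hl, hls⟩ := hs
    obtain ⟨t, ht⟩ := exists_ne s
    have h1 := eval_lineRes s l (x t) (rename Fin.succ G)
    rw [h l hl, eval_rename] at h1
    have : linePt s l (x t) ∘ Fin.succ = x := by
      funext i
      by_cases hi : i = s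
      · subst hi; simp [linePt, hls]
      · have : i = t := by omega
        subst this; simp [linePt, hi]
    rw [this] at h1
    simpa using h1.symm

end Lines

section Flex
open MvPolynomial
variable {K : Type*} [Field K]

lemma totalDegree_pderiv_le {σ : Type*} (i : σ) (Q : MvPolynomial σ K) :
    (pderiv i Q).totalDegree ≤ Q.totalDegree - 1 := by
  classical
  refine Finset.sup_le fun m hm => ?_
  rw [mem_support_iff, coeff_pderiv] at hm
  have h1 : m + Finsupp.single i 1 ∈ Q.support := by
    rw [mem_support_iff]; exact left_ne_zero_of_mul hm
  have h2 := le_totalDegree h1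
  rw [Finsupp.sum_add_index' (by simp) (by simp), Finsupp.sum_single_index rfl] at h2
  omega

lemma derivative_lineRes {s t : Fin 2} (hst : s ≠ t) (l : K × K × K) (Q : MvPolynomial (Fin 3) K) :
    Polynomial.derivative (lineRes s l Q) =
      lineRes s l (pderiv t.succ Q + C l.2.1 * pderiv 0 Q) := by
  induction Q using MvPolynomial.induction_on with
  | C r => simp [lineRes]
  | add P Q hP hQ => simp only [map_add, hP, hQ, mul_add]; ring
  | mul_X P i hP =>
    rw [map_mul, Polynomial.derivative_mul, hP]
    simp only [pderiv_mul, map_add, map_mul]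
    have hX : Polynomial.derivative (lineRes s l (X i)) =
        lineRes s l (pderiv t.succ (X i)) + lineRes s l (C l.2.1) * lineRes s l (pderiv 0 (X i)) := by
      refine Fin.cases ?_ (fun j => ?_) i
      · rw [pderiv_X_self, pderiv_X_of_ne (Fin.succ_ne_zero t).symm]
        simp [lineRes]
      · rw [pderiv_X_of_ne (Fin.succ_ne_zero j)]
        by_cases hj : j = s
        · subst hj
          rw [pderiv_X_of_ne (fun h => hst (Fin.succ_injective _ h))]
          simp [lineRes]
        · have : j = t := by omega
          subst this
          rw [pderiv_X_self]
          simp [lineRes, hj]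
    rw [hX]; ring

/-- The numerator of the second derivative in the direction `t` of the height on the surface
`Q = 0`. -/
noncomputable def flexPoly (t : Fin 2) (Q : MvPolynomial (Fin 3) K) : MvPolynomial (Fin 3) K :=
  pderiv t.succ (pderiv t.succ Q) * (pderiv 0 Q * pderiv 0 Q) -
    C 2 * (pderiv t.succ (pderiv 0 Q) * (pderiv t.succ Q * pderiv 0 Q)) +
    pderiv 0 (pderiv 0 Q) * (pderiv t.succ Q * pderiv t.succ Q)

lemma totalDegree_flexPoly_le (t : Fin 2) (Q : MvPolynomial (Fin 3) K) :
    (flexPoly t Q).totalDegree ≤ 3 * Q.totalDegree := by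
  have h1 : ∀ i, (pderiv i Q).totalDegree ≤ Q.totalDegree := fun i =>
    (totalDegree_pderiv_le i Q).trans (Nat.sub_le _ _)
  have h2 : ∀ i j, (pderiv i (pderiv j Q)).totalDegree ≤ Q.totalDegree := fun i j =>
    ((totalDegree_pderiv_le i _).trans (Nat.sub_le _ _)).trans (h1 j)
  have h3 : ∀ A B C : MvPolynomial (Fin 3) K, A.totalDegree ≤ Q.totalDegree →
      B.totalDegree ≤ Q.totalDegree → C.totalDegree ≤ Q.totalDegree →
      (A * (B * C)).totalDegree ≤ 3 * Q.totalDegree := by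
    intro A B C hA hB hC
    have := totalDegree_mul A (B * C)
    have := totalDegree_mul B C
    omega
  unfold flexPoly
  refine (totalDegree_add _ _).trans (max_le ((totalDegree_sub _ _).trans (max_le ?_ ?_)) ?_)
  · exact h3 _ _ _ (h2 _ _) (h1 _) (h1 _)
  · refine (totalDegree_mul _ _).trans ?_
    rw [totalDegree_C, zero_add]
    exact h3 _ _ _ (h2 _ _) (h1 _) (h1 _)
  · exact h3 _ _ _ (h2 _ _) (h1 _) (h1 _)

lemma pderiv_comm' {σ : Type*} (i j : σ) (Q : MvPolynomial σ K) :
    pderiv i (pderiv j Q) = pderiv j (pderiv i Q) := by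
  classical
  ext m
  simp only [coeff_pderiv]
  rw [add_right_comm]
  by_cases h : i = j
  · subst h; rfl
  · simp [h, Ne.symm h]; ring

lemma lineRes_flexPoly {s t : Fin 2} (hst : s ≠ t) (l : K × K × K) (Q : MvPolynomial (Fin 3) K) :
    ∃ W : Polynomial K, lineRes s l (flexPoly t Q) =
      lineRes s l (pderiv 0 Q) ^ 2 *
        Polynomial.derivative (Polynomial.derivative (lineRes s l Q)) +
      Polynomial.derivative (lineRes s l Q) * W := by
  have e1 := derivative_lineRes hst l Q
  have e2 := derivative_lineRes hst l (pderiv t.succ Q + C l.2.1 * pderiv 0 Q)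
  rw [← e1] at e2
  simp only [map_add, pderiv_C_mul, map_mul] at e1 e2
  rw [pderiv_comm' 0 t.succ] at e2
  refine ⟨lineRes s l (pderiv 0 (pderiv 0 Q)) *
    (Polynomial.derivative (lineRes s l Q) -
      2 * lineRes s l (C l.2.1) * lineRes s l (pderiv 0 Q)) -
    2 * lineRes s l (pderiv t.succ (pderiv 0 Q)) * lineRes s l (pderiv 0 Q), ?_⟩
  have h2 : lineRes s l (C (2 : K)) = 2 := by
    rw [show (C (2 : K) : MvPolynomial (Fin 3) K) = 2 from map_ofNat C 2, map_ofNat]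
  rw [e2]
  simp only [flexPoly, map_add, map_sub, map_mul, h2]
  have e3 : lineRes s l (pderiv t.succ Q) = Polynomial.derivative (lineRes s l Q) -
      lineRes s l (C l.2.1) * lineRes s l (pderiv 0 Q) := by rw [e1]; ring
  rw [e3]
  ring

lemma lineRes_flexPoly_eq_zero {s t : Fin 2} (hst : s ≠ t) {l : K × K × K}
    {Q : MvPolynomial (Fin 3) K} (h : lineRes s l Q = 0) : lineRes s l (flexPoly t Q) = 0 := by
  obtain ⟨W, hW⟩ := lineRes_flexPoly hst l Q
  rw [hW, h]; simp

/-- A polynomial `g` with a double root at `z` that divides a combination `u * D² g + D g * W` of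
its derivatives with `u z ≠ 0` vanishes, as long as its degree is less than the characteristic. -/
lemma eq_zero_of_dvd_second_derivative {p : ℕ} [CharP K p] {g u W : Polynomial K} {z : K}
    (hdeg : g.natDegree < p) (h0 : g.eval z = 0) (h1 : (Polynomial.derivative g).eval z = 0)
    (hu : u.eval z ≠ 0)
    (hdvd : g ∣ u * Polynomial.derivative (Polynomial.derivative g) +
      Polynomial.derivative g * W) : g = 0 := by
  by_contra hg
  obtain ⟨h, hgh, hh⟩ := Polynomial.exists_eq_pow_rootMultiplicity_mul_and_not_dvd g hg z
  set m := g.rootMultiplicity z with hm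
  have hhz : h.eval z ≠ 0 := fun h' => hh (Polynomial.dvd_iff_isRoot.2 h')
  have hmdeg : m ≤ g.natDegree := by
    have := congrArg Polynomial.natDegree hgh
    rw [Polynomial.natDegree_mul (pow_ne_zero _ (Polynomial.X_sub_C_ne_zero z))
      (by rintro rfl; simp at hh), Polynomial.natDegree_pow, Polynomial.natDegree_X_sub_C] at this
    omega
  clear_value m
  rcases m with _ | _ | m
  · rw [hgh] at h0; simp [hhz] at h0
  · rw [hgh] at h1; simp [hhz] at h1
  · set L := Polynomial.X - Polynomial.C z with hL
    have hLz : L.eval z = 0 := by simp [hL]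
    have hL' : Polynomial.derivative L = 1 := by simp [hL]
    have hL0 : L ≠ 0 := Polynomial.X_sub_C_ne_zero z
    have d1 : Polynomial.derivative g =
        L ^ (m + 1) * (((m + 2 : ℕ) : Polynomial K) * h + L * Polynomial.derivative h) := by
      rw [hgh, Polynomial.derivative_mul, Polynomial.derivative_pow, hL']
      simp only [map_natCast, Nat.add_sub_cancel]
      push_cast; ring
    have d2 : ∃ w, Polynomial.derivative (Polynomial.derivative g) =
        L ^ m * (((m + 1 : ℕ) : Polynomial K) * ((m + 2 : ℕ) : Polynomial K) * h + L * w) := by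
      refine ⟨((m + 1 : ℕ) : Polynomial K) * Polynomial.derivative h +
        ((m + 2 : ℕ) : Polynomial K) * Polynomial.derivative h + Polynomial.derivative h +
        L * Polynomial.derivative (Polynomial.derivative h), ?_⟩
      rw [d1, Polynomial.derivative_mul, Polynomial.derivative_pow, hL', Polynomial.derivative_add,
        Polynomial.derivative_mul, Polynomial.derivative_mul, hL', Polynomial.derivative_natCast]
      simp only [map_natCast, Nat.add_sub_cancel]
      push_cast; ring
    obtain ⟨w, d2⟩ := d2
    obtain ⟨v, hv⟩ := hdvd
    rw [d2, d1] at hv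
    rw [hgh] at hv
    have key : u * (((m + 1 : ℕ) : Polynomial K) * ((m + 2 : ℕ) : Polynomial K) * h + L * w) =
        L * (L * h * v - (((m + 2 : ℕ) : Polynomial K) * h + L * Polynomial.derivative h) * W) := by
      apply mul_left_cancel₀ (pow_ne_zero m hL0)
      linear_combination hv
    have := congrArg (Polynomial.eval z) key
    simp only [Polynomial.eval_mul, Polynomial.eval_add, hLz, zero_mul, add_zero,
      Polynomial.eval_natCast, mul_eq_zero, hu, hhz, or_false, false_or] at this
    rcases this with h | h
    · rw [CharP.cast_eq_zero_iff K p] at h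
      exact absurd (Nat.le_of_dvd (by omega) h) (by omega)
    · rw [CharP.cast_eq_zero_iff K p] at h
      exact absurd (Nat.le_of_dvd (by omega) h) (by omega)

/-- If `Q` divides its flex polynomial, the surface `Q = 0` contains a line in the direction `t`
through each point where `∂Q/∂y ≠ 0`. -/
lemma exists_line_of_dvd_flexPoly {p : ℕ} [CharP K p] {s t : Fin 2} (hst : s ≠ t)
    {Q : MvPolynomial (Fin 3) K} (hdeg : Q.totalDegree < p) (hflex : Q ∣ flexPoly t Q)
    {x : Fin 3 → K} (hx : eval x Q = 0) (hx' : eval x (pderiv 0 Q) ≠ 0) :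
    ∃ a b, lineRes s (x s.succ, a, b) Q = 0 ∧ linePt s (x s.succ, a, b) (x t.succ) = x := by
  set a := - eval x (pderiv t.succ Q) / eval x (pderiv 0 Q) with ha
  set l : K × K × K := (x s.succ, a, x 0 - a * x t.succ) with hl
  have hpt : linePt s l (x t.succ) = x := by
    funext i
    refine Fin.cases ?_ (fun j => ?_) i
    · simp [linePt, hl]
    · by_cases hj : j = s
      · simp [linePt, hj, hl]
      · have : j = t := by omega
        subst this
        simp [linePt, hj]
  refine ⟨a, x 0 - a * x t.succ, ?_, hpt⟩
  obtain ⟨W, hW⟩ := lineRes_flexPoly hst l Q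
  refine eq_zero_of_dvd_second_derivative (p := p) (z := x t.succ)
    (u := lineRes s l (pderiv 0 Q) ^ 2) (W := W)
    ((natDegree_lineRes_le s l Q).trans_lt hdeg) ?_ ?_ ?_ ?_
  · rw [eval_lineRes, hpt, hx]
  · rw [derivative_lineRes hst, eval_lineRes, hpt]
    simp only [map_add, map_mul, eval_C, ha]
    field_simp; ring
  · rw [Polynomial.eval_pow, eval_lineRes, hpt]
    exact pow_ne_zero _ hx'
  · rw [← hW]
    exact map_dvd _ hflex

end Flex

section Regulus
open MvPolynomial
variable {K : Type*} [Field K]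

lemma linePt_zero (s : Fin 2) (l : K × K × K) (z : K) :
    linePt s l z 0 = l.2.1 * z + l.2.2 := rfl

lemma linePt_one (s : Fin 2) (l : K × K × K) (z : K) :
    linePt s l z 1 = if 0 = s then l.1 else z := rfl

lemma linePt_two (s : Fin 2) (l : K × K × K) (z : K) :
    linePt s l z 2 = if 1 = s then l.1 else z := rfl

lemma derivative_slice {n : ℕ} (x : Fin n → K) (Q : MvPolynomial (Fin (n + 1)) K) :
    Polynomial.derivative (((finSuccEquiv K n) Q).map (eval x)) =
      ((finSuccEquiv K n) (pderiv 0 Q)).map (eval x) := by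
  induction Q using MvPolynomial.induction_on with
  | C r => simp [finSuccEquiv_apply]
  | add P Q hP hQ => simp only [map_add, Polynomial.map_add, hP, hQ]
  | mul_X P i hP =>
    rw [pderiv_mul, map_mul, map_add, map_mul, map_mul, Polynomial.map_add, Polynomial.map_mul,
      Polynomial.map_mul, Polynomial.map_mul, Polynomial.derivative_mul, hP]
    have hX : Polynomial.derivative ((finSuccEquiv K n (X i)).map (eval x)) =
        (finSuccEquiv K n (pderiv 0 (X i))).map (eval x) := by
      refine Fin.cases ?_ (fun j => ?_) i
      · simp [finSuccEquiv_X_zero]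
      · simp [finSuccEquiv_X_succ, pderiv_X_of_ne (Fin.succ_ne_zero j)]
    rw [hX]

lemma finite_setOf_eval_eq_zero {n : ℕ} {x : Fin (n + 1) → K} {Q : MvPolynomial (Fin (n + 1)) K}
    (hx : eval x (pderiv 0 Q) ≠ 0) : {y | eval (Fin.cons y (Fin.tail x)) Q = 0}.Finite := by
  have h0 : ((finSuccEquiv K n) Q).map (eval (Fin.tail x)) ≠ 0 := by
    intro h
    have h1 := derivative_slice (Fin.tail x) Q
    rw [h, Polynomial.derivative_zero] at h1
    apply hx
    rw [← Fin.cons_self_tail x, eval_eq_eval_mv_eval', ← h1, Polynomial.eval_zero]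
  refine (Polynomial.finite_setOfPred_isRoot h0).subset fun y hy => ?_
  rw [Set.mem_ofPred_eq, eval_eq_eval_mv_eval'] at hy
  exact hy

lemma eq_zero_of_vanish_on_infinite [Infinite K] {S : Set K} (hS : S.Infinite)
    {R : MvPolynomial (Fin 2) K} (h : ∀ z, ∀ q ∈ S, eval ![z, q] R = 0) : R = 0 := by
  refine MvPolynomial.funext_set (fun i => if i = 0 then Set.univ else S) (fun i => ?_)
    (fun x hx => ?_)
  · split_ifs
    · exact Set.infinite_univ
    · exact hS
  · have h1 := hx 1 (Set.mem_univ _)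
    simp only [Fin.isValue, one_ne_zero, if_false] at h1
    have := h (x 0) (x 1) h1
    rw [show ![x 0, x 1] = x by ext i; fin_cases i <;> rfl] at this
    simpa using this

/-- A surface that contains a line of both families through each of its smooth points is a
bilinear graph. -/
lemma exists_bilinear [Infinite K] {p : ℕ} [CharP K p] {Q : MvPolynomial (Fin 3) K}
    (hQ : Irreducible Q) (hdeg : Q.totalDegree < p) (h0 : Q ∣ flexPoly 0 Q) (h1 : Q ∣ flexPoly 1 Q)
    {x : Fin 3 → K} (hx : eval x Q = 0) (hx' : eval x (pderiv 0 Q) ≠ 0) :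
    ∃ e f g h : K, ∀ l, lineRes 0 l Q = 0 →
      l.2.1 = e * l.1 + g ∧ l.2.2 = f * l.1 + h := by
  classical
  have h10 : (1 : Fin 2) ≠ 0 := by decide
  obtain ⟨a0, b0, hl0, hpt0⟩ := exists_line_of_dvd_flexPoly (s := 0) (t := 1) h10.symm hdeg h1 hx hx'
  set p0 := x (Fin.succ 0) with hp0
  have hu : lineRes 0 (p0, a0, b0) (pderiv 0 Q) ≠ 0 := by
    intro h
    apply hx'
    rw [← hpt0, ← eval_lineRes, h, Polynomial.eval_zero]
  have hinf : {q | eval (linePt 0 (p0, a0, b0) q) (pderiv 0 Q) ≠ 0}.Infinite := by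
    have := (Polynomial.finite_setOfPred_isRoot hu).infinite_compl
    refine this.mono fun q hq => ?_
    simpa [Polynomial.IsRoot, eval_lineRes] using hq
  have hcol : ∀ q, eval (linePt 0 (p0, a0, b0) q) (pderiv 0 Q) ≠ 0 → ∃ a b : K,
      lineRes 1 (q, a, b) Q = 0 ∧ linePt 1 (q, a, b) p0 = linePt 0 (p0, a0, b0) q := by
    intro q hq
    have hz : eval (linePt 0 (p0, a0, b0) q) Q = 0 := by
      rw [← eval_lineRes, hl0, Polynomial.eval_zero]
    obtain ⟨a, b, hab⟩ := exists_line_of_dvd_flexPoly (s := 1) (t := 0) h10 hdeg h0 hz hq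
    exact ⟨a, b, by simpa [linePt_one, linePt_two] using hab⟩
  choose! ca cb hc hcpt using hcol
  obtain ⟨Z, hZ⟩ := Infinite.exists_subset_card_eq K (Q.totalDegree + 2)
  have hrow : ∀ q, eval (linePt 0 (p0, a0, b0) q) (pderiv 0 Q) ≠ 0 → ∃ z ∈ Z.erase p0,
      eval (linePt 1 (q, ca q, cb q) z) (pderiv 0 Q) ≠ 0 := by
    intro q hq
    by_contra! hall
    have hne : lineRes 1 (q, ca q, cb q) (pderiv 0 Q) ≠ 0 := by
      intro h
      apply hq
      rw [← hcpt q hq, ← eval_lineRes, h, Polynomial.eval_zero]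
    have hle := Polynomial.card_le_degree_of_subset_roots (Z := Z.erase p0)
      (p := lineRes 1 (q, ca q, cb q) (pderiv 0 Q)) (by
        intro z hz
        rw [Polynomial.mem_roots hne, Polynomial.IsRoot, eval_lineRes]
        exact hall z hz)
    have := Finset.pred_card_le_card_erase (s := Z) (a := p0)
    have := natDegree_lineRes_le 1 (q, ca q, cb q) (pderiv 0 Q)
    have := totalDegree_pderiv_le 0 Q
    omega
  choose! z1 hz1 hz1' using hrow
  obtain ⟨p1, hp1, hS⟩ : ∃ p1 ∈ Z.erase p0,
      ({q | eval (linePt 0 (p0, a0, b0) q) (pderiv 0 Q) ≠ 0} ∩ z1 ⁻¹' {p1}).Infinite := by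
    by_contra! h
    apply hinf
    refine ((Z.erase p0).finite_toSet.biUnion fun z hz => h z hz).subset ?_
    intro q hq
    exact Set.mem_biUnion (hz1 q hq) ⟨hq, rfl⟩
  set S := {q | eval (linePt 0 (p0, a0, b0) q) (pderiv 0 Q) ≠ 0} ∩ z1 ⁻¹' {p1} with hSdef
  have hp10 : p1 - p0 ≠ 0 := sub_ne_zero.2 (Finset.ne_of_mem_erase hp1)
  have hSy : ∀ q ∈ S, eval (linePt 1 (q, ca q, cb q) p1) (pderiv 0 Q) ≠ 0 := by
    rintro q ⟨hq, rfl⟩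
    exact hz1' q hq
  have hrow1 : ∀ q ∈ S, ∃ l : K × K, lineRes 0 (p1, l) Q = 0 ∧
      linePt 0 (p1, l) q = linePt 1 (q, ca q, cb q) p1 := by
    intro q hq
    have hz : eval (linePt 1 (q, ca q, cb q) p1) Q = 0 := by
      rw [← eval_lineRes, hc q hq.1, Polynomial.eval_zero]
    obtain ⟨a, b, hab⟩ := exists_line_of_dvd_flexPoly (s := 0) (t := 1) h10.symm hdeg h1 hz
      (hSy q hq)
    exact ⟨(a, b), hab⟩
  have hfin : {l : K × K | lineRes 0 (p1, l) Q = 0}.Finite := by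
    obtain ⟨q1, hq1, q2, hq2, hq12⟩ := hS.nontrivial
    have hf : ∀ q ∈ S, {y | eval (Fin.cons y (Fin.tail (linePt 1 (q, ca q, cb q) p1))) Q = 0}.Finite :=
      fun q hq => finite_setOf_eval_eq_zero (hSy q hq)
    refine Set.Finite.of_finite_image (f := fun l : K × K => (l.1 * q1 + l.2, l.1 * q2 + l.2))
      (((hf q1 hq1).prod (hf q2 hq2)).subset ?_) ?_
    · rintro _ ⟨l, hl, rfl⟩
      have : ∀ q, Fin.cons (l.1 * q + l.2) (Fin.tail (linePt 1 (q, ca q, cb q) p1)) =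
          linePt 0 (p1, l) q := by
        intro q; funext i; fin_cases i <;> rfl
      refine ⟨?_, ?_⟩ <;>
      · simp only [Set.mem_ofPred_eq]
        rw [this, ← eval_lineRes, hl, Polynomial.eval_zero]
    · rintro ⟨a, b⟩ - ⟨a', b'⟩ - h
      simp only [Prod.mk.injEq] at h ⊢
      have : (a - a') * (q1 - q2) = 0 := by linear_combination h.1 - h.2
      have ha : a = a' := by
        rcases mul_eq_zero.1 this with h | h
        · exact sub_eq_zero.1 h
        · exact absurd (sub_eq_zero.1 h) hq12
      subst ha
      exact ⟨rfl, by linear_combination h.1⟩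
  choose! l1 hl1 hl1pt using hrow1
  obtain ⟨⟨a1, b1⟩, hT⟩ : ∃ l, (S ∩ l1 ⁻¹' {l}).Infinite := by
    by_contra! h
    apply hS
    refine (hfin.biUnion fun l _ => h l).subset ?_
    intro q hq
    exact Set.mem_biUnion (hl1 q hq) ⟨hq, rfl⟩
  set T := S ∩ l1 ⁻¹' {(a1, b1)} with hTdef
  set e := (a1 - a0) / (p1 - p0) with he
  set f := (b1 - b0) / (p1 - p0) with hf
  have he' : e * (p1 - p0) = a1 - a0 := by rw [he]; field_simp
  have hf' : f * (p1 - p0) = b1 - b0 := by rw [hf]; field_simp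
  clear_value e f
  set B : MvPolynomial (Fin 2) K := C e * (X 0 * X 1) + C f * X 0 + C (a0 - e * p0) * X 1 +
    C (b0 - f * p0) with hB
  have hR : (finSuccEquiv K 2 Q).eval B = 0 := by
    refine eq_zero_of_vanish_on_infinite hT fun z q hq => ?_
    have e1 := congrFun (hcpt q hq.1.1) 0
    have e2 := congrFun (hl1pt q hq.1) 0
    rw [show l1 q = (a1, b1) from hq.2] at e2
    simp only [linePt, Fin.cons_zero] at e1 e2
    have ea : ca q = e * q + f := by
      apply mul_right_cancel₀ hp10
      linear_combination -e1 - e2 - q * he' - hf'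
    have e3 : eval ![z, q] B = ca q * z + cb q := by
      simp only [hB, map_add, map_mul, eval_C, eval_X]
      simp only [Matrix.cons_val_zero, Matrix.cons_val_one]
      linear_combination -e1 + (p0 - z) * ea
    have e4 : eval (linePt 1 (q, ca q, cb q) z) Q = 0 := by
      rw [← eval_lineRes, hc q hq.1.1, Polynomial.eval_zero]
    rw [show linePt 1 (q, ca q, cb q) z = Fin.cons (ca q * z + cb q) ![z, q] by
      funext i; fin_cases i <;> rfl, eval_eq_eval_mv_eval', ← e3,
      Polynomial.eval_map_apply] at e4
    exact e4
  have hdvd : Polynomial.X - Polynomial.C B ∣ finSuccEquiv K 2 Q := Polynomial.dvd_iff_isRoot.2 hR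
  have hirr : Irreducible (finSuccEquiv K 2 Q) := (MulEquiv.irreducible_iff (finSuccEquiv K 2)).2 hQ
  have hassoc := (hirr.dvd_iff.1 hdvd).resolve_left (Polynomial.not_isUnit_X_sub_C B)
  have hdvd' : Q ∣ X 0 - rename Fin.succ B := by
    rw [← map_dvd_iff (finSuccEquiv K 2)]
    refine hassoc.dvd.trans (dvd_of_eq ?_)
    rw [map_sub, finSuccEquiv_rename_succ, finSuccEquiv_X_zero]
  refine ⟨e, f, a0 - e * p0, b0 - f * p0, fun l hl => ?_⟩
  have hz : lineRes 0 l (X 0 - rename Fin.succ B) = 0 := by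
    obtain ⟨w, hw⟩ := hdvd'
    rw [hw, map_mul, hl, zero_mul]
  have hz' : ∀ z : K, l.2.1 * z + l.2.2 -
      (e * (l.1 * z) + f * l.1 + (a0 - e * p0) * z + (b0 - f * p0)) = 0 := by
    intro z
    have := congrArg (Polynomial.eval z) hz
    rw [eval_lineRes, Polynomial.eval_zero] at this
    rw [← this]
    simp [hB, linePt_zero, linePt_one, linePt_two]
  have z0 := hz' 0
  have z1 := hz' 1
  constructor
  · linear_combination z1 - z0
  · linear_combination z0

end Regulus

section Incidences
open MvPolynomial
variable {K : Type*} [Field K]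

open Classical in
/-- The number of incidences between two families of lines. -/
noncomputable def inc (L₁ L₂ : Finset (K × K × K)) : ℕ :=
  ((L₁ ×ˢ L₂).filter fun q => Meets q.1 q.2).card

open Classical in
lemma inc_eq_sum (L₁ L₂ : Finset (K × K × K)) :
    inc L₁ L₂ = ∑ m ∈ L₂, (L₁.filter fun l => Meets l m).card := by
  unfold inc
  rw [Finset.card_filter, Finset.sum_product_right]
  simp only [Finset.card_filter]

lemma inc_comm (L₁ L₂ : Finset (K × K × K)) : inc L₁ L₂ = inc L₂ L₁ := by
  classical
  refine Finset.card_bij' (fun q _ => q.swap) (fun q _ => q.swap) (fun q hq => ?_) (fun q hq => ?_)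
    (fun _ _ => rfl) (fun _ _ => rfl) <;>
  · simp only [Finset.mem_filter, Finset.mem_product, Prod.fst_swap, Prod.snd_swap] at hq ⊢
    exact ⟨hq.1.symm, hq.2.symm⟩

open Classical in
lemma inc_le_mul (L₁ L₂ : Finset (K × K × K)) : inc L₁ L₂ ≤ L₁.card * L₂.card :=
  (Finset.card_filter_le _ _).trans (Finset.card_product _ _).le

open Classical in
lemma inc_le_of_forall {L₁ L₂ : Finset (K × K × K)} {k : ℕ}
    (h : ∀ m ∈ L₂, (L₁.filter fun l => Meets l m).card ≤ k) : inc L₁ L₂ ≤ k * L₂.card := by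
  rw [inc_eq_sum, mul_comm, ← smul_eq_mul]
  exact Finset.sum_le_card_nsmul _ _ _ h

lemma inc_filter_add (L₁ L₂ : Finset (K × K × K)) (p : K × K × K → Prop) [DecidablePred p]
    [DecidablePred fun m => ¬ p m] :
    inc L₁ (L₂.filter p) + inc L₁ (L₂.filter fun m => ¬ p m) = inc L₁ L₂ := by
  classical
  simp only [inc_eq_sum]
  exact Finset.sum_filter_add_sum_filter_not _ _ _

lemma inc_filter_left_add (L₁ L₂ : Finset (K × K × K)) (p : K × K × K → Prop) [DecidablePred p]
    [DecidablePred fun m => ¬ p m] :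
    inc (L₁.filter p) L₂ + inc (L₁.filter fun m => ¬ p m) L₂ = inc L₁ L₂ := by
  simp only [inc_comm _ L₂]
  exact inc_filter_add _ _ _

open Classical in
lemma card_filter_meets_le {s t : Fin 2} (hst : s ≠ t) {L : Finset (K × K × K)}
    (hL : Set.InjOn Prod.fst (L : Set (K × K × K))) {H : MvPolynomial (Fin 3) K}
    (hH : ∀ l ∈ L, lineRes s l H = 0) {m : K × K × K} (hm : lineRes t m H ≠ 0) :
    (L.filter fun l => Meets l m).card ≤ H.totalDegree := by
  rw [← Finset.card_image_of_injOn (f := Prod.fst)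
    (hL.mono (by exact_mod_cast Finset.filter_subset _ _))]
  refine (Polynomial.card_le_degree_of_subset_roots (p := lineRes t m H) ?_).trans
    (natDegree_lineRes_le _ _ _)
  intro z hz
  simp only [Finset.image_val, Multiset.mem_dedup, Multiset.mem_map] at hz
  obtain ⟨l, hl, rfl⟩ := hz
  rw [Finset.mem_val, Finset.mem_filter] at hl
  rw [Polynomial.mem_roots hm, Polynomial.IsRoot, eval_lineRes, ← hl.2.linePt_eq hst,
    ← eval_lineRes, hH l hl.1, Polynomial.eval_zero]

lemma card_le_of_not_dvd [Infinite K] (s : Fin 2) {Q H : MvPolynomial (Fin 3) K}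
    (hQ : Irreducible Q) (hQ0 : (finSuccEquiv K 2 Q).natDegree ≠ 0) (hQH : ¬ Q ∣ H)
    {L : Finset (K × K × K)} (hL : Set.InjOn Prod.fst (L : Set (K × K × K)))
    (hLQ : ∀ l ∈ L, lineRes s l Q = 0) (hLH : ∀ l ∈ L, lineRes s l H = 0) :
    L.card ≤ 2 * (Q.totalDegree * H.totalDegree) := by
  obtain ⟨G, hG, hdeg, u, v, huv⟩ := exists_eliminant hQ hQ0 hQH
  refine (card_le_of_vanish_on_lines s hG L hL fun l hl => ?_).trans hdeg
  rw [huv, map_add, map_mul, map_mul, hLQ l hl, hLH l hl, zero_mul, zero_mul, add_zero]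

/-- Incidences between lines on an irreducible surface `Q = 0`, when the first family also lies on
another surface `H = 0` of low degree. -/
lemma inc_le_of_vanish [Infinite K] {s t : Fin 2} (hst : s ≠ t) {Q H : MvPolynomial (Fin 3) K}
    (hQ : Irreducible Q) (hQ0 : (finSuccEquiv K 2 Q).natDegree ≠ 0) (hQH : ¬ Q ∣ H)
    (hH : H.totalDegree ≤ 3 * Q.totalDegree) {L M : Finset (K × K × K)}
    (hL : Set.InjOn Prod.fst (L : Set (K × K × K))) (hM : Set.InjOn Prod.fst (M : Set (K × K × K)))
    (hLQ : ∀ l ∈ L, lineRes s l Q = 0) (hMQ : ∀ m ∈ M, lineRes t m Q = 0)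
    (hLH : ∀ l ∈ L, lineRes s l H = 0) {F : ℝ}
    (hF : ∀ L' ⊆ L, ∀ M' ⊆ M, L'.card ≤ 6 * Q.totalDegree ^ 2 → M'.card ≤ 6 * Q.totalDegree ^ 2 →
      (inc L' M' : ℝ) ≤ F) :
    (inc L M : ℝ) ≤ 3 * Q.totalDegree * M.card + F := by
  classical
  rw [← inc_filter_add L M fun m => lineRes t m H ≠ 0]
  have hd : 2 * (Q.totalDegree * H.totalDegree) ≤ 6 * Q.totalDegree ^ 2 := by nlinarith
  have h1 : inc L (M.filter fun m => lineRes t m H ≠ 0) ≤ 3 * Q.totalDegree * M.card := by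
    refine (inc_le_of_forall fun m hm => ?_).trans
      (Nat.mul_le_mul_left _ (Finset.card_filter_le _ _))
    exact (card_filter_meets_le hst hL hLH (Finset.mem_filter.1 hm).2).trans hH
  have h2 := hF L subset_rfl (M.filter fun m => ¬ lineRes t m H ≠ 0) (Finset.filter_subset _ _)
    ((card_le_of_not_dvd s hQ hQ0 hQH hL hLQ hLH).trans hd)
    ((card_le_of_not_dvd t hQ hQ0 hQH (hM.mono (by exact_mod_cast Finset.filter_subset _ _))
      (fun m hm => hMQ m (Finset.mem_filter.1 hm).1)
      (fun m hm => by simpa using (Finset.mem_filter.1 hm).2)).trans hd)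
  push_cast
  have h1' : (inc L (M.filter fun m => lineRes t m H ≠ 0) : ℝ) ≤ 3 * Q.totalDegree * M.card := by
    exact_mod_cast h1
  linarith

lemma not_dvd_pderiv_zero {p : ℕ} [CharP K p] {n : ℕ} {Q : MvPolynomial (Fin (n + 1)) K}
    (hdeg : Q.totalDegree < p) (hQ0 : (finSuccEquiv K n Q).natDegree ≠ 0) :
    ¬ Q ∣ pderiv 0 Q := by
  classical
  rw [natDegree_finSuccEquiv] at hQ0
  have hQd : 0 < Q.totalDegree :=
    (Nat.pos_of_ne_zero hQ0).trans_le (degreeOf_le_totalDegree _ _)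
  have hne : pderiv 0 Q ≠ 0 := by
    obtain ⟨m, hm, hm0⟩ : ∃ m ∈ Q.support, m 0 ≠ 0 := by
      by_contra! h
      apply hQ0
      rw [degreeOf_eq_sup]
      simpa using h
    intro h
    have h1 := congrArg (coeff (m - Finsupp.single 0 1)) h
    rw [coeff_pderiv, coeff_zero, tsub_add_cancel_of_le
      (Finsupp.single_le_iff.2 (Nat.one_le_iff_ne_zero.2 hm0))] at h1
    rcases mul_eq_zero.1 h1 with h2 | h2
    · exact (mem_support_iff.1 hm) h2
    · have h3 : ((m 0 : ℕ) : K) = 0 := by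
        rw [← h2]
        simp only [Finsupp.coe_tsub, Pi.sub_apply, Finsupp.single_eq_same]
        norm_cast
        rw [Nat.sub_add_cancel (Nat.one_le_iff_ne_zero.2 hm0)]
      rw [CharP.cast_eq_zero_iff K p] at h3
      have h4 := Nat.le_of_dvd (Nat.pos_of_ne_zero hm0) h3
      have h5 : m 0 ≤ degreeOf 0 Q := monomial_le_degreeOf 0 hm
      have h6 := degreeOf_le_totalDegree Q 0
      omega
  rintro ⟨w, hw⟩
  have hQne : Q ≠ 0 := by rintro rfl; simp at hne
  have hwne : w ≠ 0 := by rintro rfl; simp at hw; exact hne hw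
  have h1 := totalDegree_mul_of_isDomain hQne hwne
  rw [← hw] at h1
  have := totalDegree_pderiv_le 0 Q
  omega

open Classical in
/-- At most `k` lines of the family lie on any bilinear graph. -/
def BilinearBound (k : ℕ) (L : Finset (K × K × K)) : Prop :=
  ∀ e f g h : K, (L.filter fun l => l.2.1 = e * l.1 + g ∧ l.2.2 = f * l.1 + h).card ≤ k

open Classical in
lemma BilinearBound.mono {k : ℕ} {L M : Finset (K × K × K)} (h : BilinearBound k M) (hLM : L ⊆ M) :
    BilinearBound k L :=
  fun a b c d => (Finset.card_le_card (Finset.filter_subset_filter _ hLM)).trans (h a b c d)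

/-- Incidences between two families of lines on an irreducible surface. -/
lemma inc_le_of_irreducible [Infinite K] {p : ℕ} [CharP K p] {Q : MvPolynomial (Fin 3) K}
    (hQ : Irreducible Q) (hdeg : Q.totalDegree < p) {L M : Finset (K × K × K)}
    (hL : Set.InjOn Prod.fst (L : Set (K × K × K))) (hM : Set.InjOn Prod.fst (M : Set (K × K × K)))
    (hLQ : ∀ l ∈ L, lineRes 0 l Q = 0) (hMQ : ∀ m ∈ M, lineRes 1 m Q = 0) {k : ℕ}
    (hk : BilinearBound k L) {F : ℝ} (hF0 : 0 ≤ F)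
    (hF : ∀ L' ⊆ L, ∀ M' ⊆ M, L'.card ≤ 6 * Q.totalDegree ^ 2 → M'.card ≤ 6 * Q.totalDegree ^ 2 →
      (inc L' M' : ℝ) ≤ F) :
    (inc L M : ℝ) ≤ k * M.card + 3 * Q.totalDegree * (L.card + M.card) + F := by
  classical
  have h01 : (0 : Fin 2) ≠ 1 := by decide
  have hpos1 : (0 : ℝ) ≤ k * M.card := by positivity
  have hpos2 : (0 : ℝ) ≤ 3 * Q.totalDegree * L.card := by positivity
  have hpos3 : (0 : ℝ) ≤ 3 * Q.totalDegree * M.card := by positivity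
  by_cases hQ0 : (finSuccEquiv K 2 Q).natDegree = 0
  · obtain ⟨G, hG⟩ : ∃ G, Q = rename Fin.succ G := by
      refine ⟨(finSuccEquiv K 2 Q).coeff 0, ?_⟩
      apply (finSuccEquiv K 2).injective
      rw [finSuccEquiv_rename_succ]
      exact Polynomial.eq_C_of_natDegree_eq_zero hQ0
    have hG0 : G ≠ 0 := by rintro rfl; rw [map_zero] at hG; exact hQ.ne_zero hG
    have hGd : G.totalDegree ≤ Q.totalDegree := by
      have hc : (finSuccEquiv K 2 Q).coeff 0 = G := by
        rw [hG, finSuccEquiv_rename_succ, Polynomial.coeff_C_zero]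
      have := totalDegree_coeff_finSuccEquiv_add_le Q 0 (by rwa [hc])
      rwa [hc] at this
    have hle : G.totalDegree ≤ 6 * Q.totalDegree ^ 2 := by nlinarith
    have := hF L subset_rfl M subset_rfl
      ((card_le_of_vanish_on_lines 0 hG0 L hL (by rw [← hG]; exact hLQ)).trans hle)
      ((card_le_of_vanish_on_lines 1 hG0 M hM (by rw [← hG]; exact hMQ)).trans hle)
    linarith
  by_cases hf1 : Q ∣ flexPoly 1 Q
  swap
  · have := inc_le_of_vanish h01 hQ hQ0 hf1 (totalDegree_flexPoly_le 1 Q) hL hM hLQ hMQ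
      (fun l hl => lineRes_flexPoly_eq_zero h01 (hLQ l hl)) hF
    linarith
  by_cases hf0 : Q ∣ flexPoly 0 Q
  swap
  · have := inc_le_of_vanish h01.symm hQ hQ0 hf0 (totalDegree_flexPoly_le 0 Q) hM hL hMQ hLQ
      (fun l hl => lineRes_flexPoly_eq_zero h01.symm (hMQ l hl))
      (fun L' hL' M' hM' h1 h2 => by rw [inc_comm]; exact hF M' hM' L' hL' h2 h1)
    rw [inc_comm] at this
    linarith
  by_cases hy : ∀ l ∈ L, lineRes 0 l (pderiv 0 Q) = 0
  · have := inc_le_of_vanish h01 hQ hQ0 (not_dvd_pderiv_zero hdeg hQ0)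
      (by have := totalDegree_pderiv_le 0 Q; omega) hL hM hLQ hMQ hy hF
    linarith
  push Not at hy
  obtain ⟨l, hl, hly⟩ := hy
  obtain ⟨z, hz⟩ : ∃ z, (lineRes 0 l (pderiv 0 Q)).eval z ≠ 0 := by
    by_contra! h
    exact hly (Polynomial.funext fun z => by simpa using h z)
  rw [eval_lineRes] at hz
  obtain ⟨e, f, g, h, hb⟩ := exists_bilinear hQ hdeg hf0 hf1 (x := linePt 0 l z)
    (by rw [← eval_lineRes, hLQ l hl, Polynomial.eval_zero]) hz
  have h1 : inc L M ≤ k * M.card := by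
    refine inc_le_of_forall fun m _ => ?_
    refine (Finset.card_le_card fun l' hl' => ?_).trans (hk e f g h)
    exact Finset.mem_filter.2 ⟨(Finset.mem_filter.1 hl').1, hb l' (hLQ l' (Finset.mem_filter.1 hl').1)⟩
  have h2 : (inc L M : ℝ) ≤ k * M.card := by exact_mod_cast h1
  linarith

/-- Incidences between two families of lines on the surface `Q = 0`. -/
lemma inc_le_of_ne_zero [Infinite K] {p : ℕ} [CharP K p] {k : ℕ} {Φ : ℕ → ℝ} (hΦ0 : ∀ d, 0 ≤ Φ d)
    (hΦ : ∀ d e, Φ d + Φ e ≤ Φ (d + e)) (Q : MvPolynomial (Fin 3) K) :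
    Q ≠ 0 → Q.totalDegree < p → ∀ L M : Finset (K × K × K),
    Set.InjOn Prod.fst (L : Set (K × K × K)) → Set.InjOn Prod.fst (M : Set (K × K × K)) →
    (∀ l ∈ L, lineRes 0 l Q = 0) → (∀ m ∈ M, lineRes 1 m Q = 0) → BilinearBound k L →
    (∀ d ≤ Q.totalDegree, ∀ L' ⊆ L, ∀ M' ⊆ M, L'.card ≤ 6 * d ^ 2 → M'.card ≤ 6 * d ^ 2 →
      (inc L' M' : ℝ) ≤ Φ d) →
    (inc L M : ℝ) ≤ k * M.card + 4 * Q.totalDegree * (L.card + M.card) + Φ Q.totalDegree := by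
  classical
  induction Q using WfDvdMonoid.induction_on_irreducible with
  | zero => exact fun h => absurd rfl h
  | unit u hu =>
    intro _ _ L M _ _ hL _ _ _
    have : L = ∅ := by
      refine Finset.eq_empty_of_forall_notMem fun l hl => ?_
      have := hu.map (lineRes 0 l)
      rw [hL l hl] at this
      exact not_isUnit_zero this
    have h0 : inc L M = 0 := by
      have := inc_le_mul L M
      rw [‹L = ∅›] at this ⊢
      simpa using this
    rw [h0]
    have := hΦ0 u.totalDegree
    push_cast
    positivity
  | mul a q ha hq ih =>
    intro hne hdeg L M hL hM hLQ hMQ hk hF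
    have hadd := totalDegree_mul_of_isDomain hq.ne_zero ha
    rw [hadd] at hdeg hF ⊢
    set L₁ := L.filter fun l => lineRes 0 l q = 0 with hL₁
    set L₂ := L.filter fun l => ¬ lineRes 0 l q = 0 with hL₂
    set M₁ := M.filter fun l => lineRes 1 l q = 0 with hM₁
    set M₂ := M.filter fun l => ¬ lineRes 1 l q = 0 with hM₂
    have sL₁ : L₁ ⊆ L := Finset.filter_subset _ _
    have sL₂ : L₂ ⊆ L := Finset.filter_subset _ _
    have sM₁ : M₁ ⊆ M := Finset.filter_subset _ _
    have sM₂ : M₂ ⊆ M := Finset.filter_subset _ _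
    have hLinj : ∀ L' ⊆ L, Set.InjOn Prod.fst (L' : Set (K × K × K)) := fun L' h =>
      hL.mono (by exact_mod_cast h)
    have hMinj : ∀ M' ⊆ M, Set.InjOn Prod.fst (M' : Set (K × K × K)) := fun M' h =>
      hM.mono (by exact_mod_cast h)
    have hcL : (L₁.card : ℝ) + L₂.card = L.card := by
      exact_mod_cast Finset.card_filter_add_card_filter_not _
    have hcM : (M₁.card : ℝ) + M₂.card = M.card := by
      exact_mod_cast Finset.card_filter_add_card_filter_not _
    have hq1 : ∀ l ∈ L₁, lineRes 0 l q = 0 := fun l hl => (Finset.mem_filter.1 hl).2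
    have hq2 : ∀ m ∈ M₁, lineRes 1 m q = 0 := fun l hl => (Finset.mem_filter.1 hl).2
    have h12 : (inc L₁ M₂ : ℝ) ≤ q.totalDegree * M₂.card := by
      have : inc L₁ M₂ ≤ q.totalDegree * M₂.card := inc_le_of_forall fun m hm =>
        card_filter_meets_le (s := 0) (t := 1) (by decide) (hLinj L₁ sL₁) hq1
          (Finset.mem_filter.1 hm).2
      exact_mod_cast this
    have h21 : (inc L₂ M₁ : ℝ) ≤ q.totalDegree * L₂.card := by
      have : inc M₁ L₂ ≤ q.totalDegree * L₂.card := inc_le_of_forall fun m hm =>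
        card_filter_meets_le (s := 1) (t := 0) (by decide) (hMinj M₁ sM₁) hq2
          (Finset.mem_filter.1 hm).2
      rw [inc_comm]
      exact_mod_cast this
    have h11 := inc_le_of_irreducible hq (by omega : q.totalDegree < p) (hLinj L₁ sL₁)
      (hMinj M₁ sM₁) hq1 hq2 (hk.mono sL₁) (hΦ0 q.totalDegree)
      (fun L' hL' M' hM' => hF q.totalDegree (by omega) L' (hL'.trans sL₁) M'
        (hM'.trans sM₁))
    have h22 := ih ha (by omega) L₂ M₂ (hLinj L₂ sL₂) (hMinj M₂ sM₂)
      (fun l hl => by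
        have h := hLQ l (sL₂ hl)
        rw [map_mul] at h
        exact (mul_eq_zero.1 h).resolve_left (Finset.mem_filter.1 hl).2)
      (fun l hl => by
        have h := hMQ l (sM₂ hl)
        rw [map_mul] at h
        exact (mul_eq_zero.1 h).resolve_left (Finset.mem_filter.1 hl).2)
      (hk.mono sL₂)
      (fun d hd L' hL' M' hM' => hF d (by omega) L' (hL'.trans sL₂) M'
        (hM'.trans sM₂))
    have hsplit : inc L₁ M₁ + inc L₂ M₁ + (inc L₁ M₂ + inc L₂ M₂) = inc L M := by
      rw [hL₁, hL₂, hM₁, hM₂, inc_filter_left_add, inc_filter_left_add, inc_filter_add]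
    have hs := hΦ q.totalDegree a.totalDegree
    rw [← hsplit, ← hcL, ← hcM]
    push_cast
    clear_value L₁ L₂ M₁ M₂
    have p1 : (0 : ℝ) ≤ q.totalDegree * L₁.card := by positivity
    have p2 : (0 : ℝ) ≤ q.totalDegree * L₂.card := by positivity
    have p3 : (0 : ℝ) ≤ q.totalDegree * M₁.card := by positivity
    have p4 : (0 : ℝ) ≤ q.totalDegree * M₂.card := by positivity
    have p5 : (0 : ℝ) ≤ a.totalDegree * L₁.card := by positivity
    have p6 : (0 : ℝ) ≤ a.totalDegree * M₁.card := by positivity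
    linarith

/-- A surface of low degree through `L.card` lines of the first family. -/
lemma exists_surface (s : Fin 2) (L : Finset (K × K × K)) :
    ∃ Q : MvPolynomial (Fin 3) K, Q ≠ 0 ∧ Q.totalDegree ≤ 3 * Nat.sqrt (3 * L.card) ∧
      ∀ l ∈ L, lineRes s l Q = 0 := by
  classical
  set D := Nat.sqrt (3 * L.card) with hD
  have hlt : 3 * L.card < (D + 1) * (D + 1) := Nat.lt_succ_sqrt (3 * L.card)
  let poly : ((Fin 3 → Fin (D + 1)) → K) →ₗ[K] MvPolynomial (Fin 3) K :=
    Fintype.linearCombination K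
      (fun f => monomial (Finsupp.equivFunOnFinite.symm fun i => (f i : ℕ)) (1 : K))
  have hpoly : ∀ c, poly c = ∑ f, monomial (Finsupp.equivFunOnFinite.symm fun i => (f i : ℕ)) (c f) := by
    intro c
    simp [poly, Fintype.linearCombination_apply, smul_monomial]
  have hdeg : ∀ c, (poly c).totalDegree ≤ 3 * D := by
    intro c
    rw [hpoly]
    refine totalDegree_finsetSum_le fun f _ => ?_
    refine (totalDegree_monomial_le _ _).trans ?_
    rw [Finsupp.sum_fintype _ _ (fun _ => rfl), Fin.sum_univ_three]
    have := (f 0).2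
    have := (f 1).2
    have := (f 2).2
    simp only [Finsupp.equivFunOnFinite_symm_apply_apply, id]
    omega
  have hinj : ∀ c, poly c = 0 → c = 0 := by
    intro c h
    funext f
    have h1 := congrArg (coeff (Finsupp.equivFunOnFinite.symm fun i => (f i : ℕ))) h
    rw [hpoly, coeff_sum, coeff_zero, Finset.sum_eq_single f] at h1
    · simpa using h1
    · intro g _ hg
      rw [coeff_monomial, if_neg]
      intro h2
      apply hg
      have h3 := Finsupp.equivFunOnFinite.symm.injective h2
      funext i
      exact Fin.ext (congrFun h3 i)
    · simp
  let ev : ((Fin 3 → Fin (D + 1)) → K) →ₗ[K] (L × Fin (3 * D + 1) → K) :=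
    LinearMap.pi fun x => (Polynomial.lcoeff K (x.2 : ℕ)) ∘ₗ (lineRes s x.1.1).toLinearMap ∘ₗ poly
  have hker : ev.ker ≠ ⊥ := by
    apply LinearMap.ker_ne_bot_of_finrank_lt
    simp only [Module.finrank_fintype_fun_eq_card, Fintype.card_prod, Fintype.card_fin,
      Fintype.card_coe, Fintype.card_fun]
    nlinarith
  obtain ⟨c, hc, hc0⟩ := Submodule.exists_mem_ne_zero_of_ne_bot hker
  refine ⟨poly c, fun h => hc0 (hinj c h), hdeg c, fun l hl => ?_⟩
  ext i
  rw [Polynomial.coeff_zero]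
  by_cases hi : i < 3 * D + 1
  · exact congrFun (LinearMap.mem_ker.1 hc) (⟨l, hl⟩, ⟨i, hi⟩)
  · apply Polynomial.coeff_eq_zero_of_natDegree_lt
    have := natDegree_lineRes_le s l (poly c)
    have := hdeg c
    omega

end Incidences

section Recursion
open MvPolynomial

lemma inc_le_of_small_subsets {K : Type*} [Field K] {M : Finset (K × K × K)} {n : ℕ} {B : ℝ} (T : ℕ) :
    ∀ L : Finset (K × K × K), L.card ≤ T * n → (∀ L' ⊆ L, L'.card ≤ n → (inc L' M : ℝ) ≤ B) →
      (inc L M : ℝ) ≤ T * B := by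
  classical
  induction T with
  | zero =>
    intro L hL _
    have : L = ∅ := by simpa using hL
    have := inc_le_mul L M
    simp_all
  | succ T ih =>
    intro L hL h
    obtain ⟨L', hL', hc⟩ := Finset.exists_subset_card_eq (min_le_left L.card n)
    have h1 := h L' hL' (by omega)
    have h2 := ih (L \ L') (by rw [Finset.card_sdiff_of_subset hL', hc, Nat.succ_mul] at *; omega)
      (fun L'' h'' => h L'' (h''.trans Finset.sdiff_subset))
    have h3 : (inc L M : ℝ) = inc L' M + inc (L \ L') M := by
      rw [← inc_filter_left_add L M fun l => l ∈ L', Finset.filter_mem_eq_inter,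
        Finset.inter_eq_right.2 hL', Finset.filter_notMem_eq_sdiff]
      push_cast; rfl
    rw [h3]; push_cast; linarith

/-- Incidences of a small family `L` with a large one, given a bound for smaller families. -/
lemma inc_le_step {K : Type*} [Field K] [Infinite K] {p : ℕ} [CharP K p] {k n : ℕ} {Φ : ℕ → ℝ}
    (hΦ0 : ∀ d, 0 ≤ Φ d) (hΦ : ∀ d e, Φ d + Φ e ≤ Φ (d + e)) (hn : 27 * n < p ^ 2)
    {L M : Finset (K × K × K)}
    (hL : Set.InjOn Prod.fst (L : Set (K × K × K))) (hM : Set.InjOn Prod.fst (M : Set (K × K × K)))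
    (hk : BilinearBound k L) (hLn : L.card ≤ n)
    (hF : ∀ d, d ^ 2 ≤ 27 * n → ∀ L' ⊆ L, ∀ M' ⊆ M, L'.card ≤ 6 * d ^ 2 → M'.card ≤ 6 * d ^ 2 →
      (inc L' M' : ℝ) ≤ Φ d) :
    ∃ D : ℕ, D ^ 2 ≤ 27 * n ∧
      (inc L M : ℝ) ≤ k * M.card + 4 * D * L.card + 5 * D * M.card + Φ D := by
  classical
  obtain ⟨Q, hQ, hdeg, hLQ⟩ := exists_surface 0 L
  have hD : Q.totalDegree ^ 2 ≤ 27 * n := by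
    have := Nat.sqrt_le (3 * L.card)
    nlinarith
  refine ⟨Q.totalDegree, hD, ?_⟩
  set M₁ := M.filter fun m => lineRes 1 m Q = 0 with hM₁
  set M₂ := M.filter fun m => ¬ lineRes 1 m Q = 0 with hM₂
  have sM₁ : M₁ ⊆ M := Finset.filter_subset _ _
  have h1 := inc_le_of_ne_zero hΦ0 hΦ Q hQ (lt_of_pow_lt_pow_left₀ 2 (Nat.zero_le p) (hD.trans_lt hn))
    L M₁ hL (hM.mono (by exact_mod_cast sM₁)) hLQ (fun m hm => (Finset.mem_filter.1 hm).2) hk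
    (fun d hd L' hL' M' hM' => hF d ((Nat.pow_le_pow_left hd 2).trans hD) L' hL' M' (hM'.trans sM₁))
  have h2 : inc L M₂ ≤ Q.totalDegree * M₂.card := inc_le_of_forall fun m hm =>
    card_filter_meets_le (s := 0) (t := 1) (by decide) hL hLQ (Finset.mem_filter.1 hm).2
  have h2' : (inc L M₂ : ℝ) ≤ Q.totalDegree * M₂.card := by exact_mod_cast h2
  have hsplit : inc L M₁ + inc L M₂ = inc L M := by
    rw [hM₁, hM₂, inc_filter_add]
  have hcM : (M₁.card : ℝ) + M₂.card = M.card := by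
    exact_mod_cast Finset.card_filter_add_card_filter_not _
  rw [← hsplit, ← hcM]
  push_cast
  clear_value M₁ M₂
  have p1 : (0 : ℝ) ≤ Q.totalDegree * M₁.card := by positivity
  have p2 : (0 : ℝ) ≤ Q.totalDegree * M₂.card := by positivity
  have p3 : (0 : ℝ) ≤ k * M₂.card := by positivity
  linarith

lemma exists_large {δ : ℝ} (hδ : 0 < δ) : ∃ T : ℕ, 324 < T ∧ (324 / T : ℝ) ^ δ ≤ 1 / 648 := by
  refine ⟨⌈324 * (648 : ℝ) ^ (1 / δ)⌉₊ + 325, by omega, ?_⟩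
  have h1 : 324 * (648 : ℝ) ^ (1 / δ) ≤ ((⌈324 * (648 : ℝ) ^ (1 / δ)⌉₊ + 325 : ℕ) : ℝ) := by
    push_cast
    linarith [Nat.le_ceil (324 * (648 : ℝ) ^ (1 / δ))]
  set T := ((⌈324 * (648 : ℝ) ^ (1 / δ)⌉₊ + 325 : ℕ) : ℝ)
  have h0 : (0 : ℝ) < (648 : ℝ) ^ (1 / δ) := by positivity
  have h2 : 324 / T ≤ ((648 : ℝ) ^ (1 / δ))⁻¹ := by
    rw [div_le_iff₀ (by linarith), ← div_eq_inv_mul, le_div_iff₀ h0]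
    exact h1
  have hT : 0 ≤ 324 / T := by positivity
  calc (324 / T) ^ δ ≤ (((648 : ℝ) ^ (1 / δ))⁻¹) ^ δ := Real.rpow_le_rpow hT h2 hδ.le
    _ = 1 / 648 := by
      rw [Real.inv_rpow h0.le, ← Real.rpow_mul (by norm_num), one_div_mul_cancel hδ.ne', Real.rpow_one,
        one_div]

/-- The number of incidences between `N` rows and `N` columns, at most `k` rows lying on any
bilinear graph, is essentially at most `N ^ (3 / 2) + k * N`. -/
theorem exists_inc_le {δ : ℝ} (hδ : 0 < δ) : ∃ C : ℝ, 0 < C ∧ ∀ (K : Type*) [Field K] [Infinite K]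
    (p : ℕ) [CharP K p] (k : ℕ), 1 ≤ k → ∀ N : ℕ, 100 * N ≤ p ^ 2 → ∀ L M : Finset (K × K × K),
    Set.InjOn Prod.fst (L : Set (K × K × K)) → Set.InjOn Prod.fst (M : Set (K × K × K)) →
    BilinearBound k L → L.card ≤ N → M.card ≤ N →
    (inc L M : ℝ) ≤ N * (C * (N : ℝ) ^ δ * ((N : ℝ) ^ (1 / 2 : ℝ) + k)) := by
  obtain ⟨T, hT, hTδ⟩ := exists_large hδ
  have hTR : (324 : ℝ) < T := by exact_mod_cast hT
  refine ⟨146 * T, by positivity, ?_⟩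
  intro K _ _ p _ k hk N
  set ψ : ℝ → ℝ := fun x => 146 * T * x ^ δ * (x ^ (1 / 2 : ℝ) + k) with hψ
  have hψ0 : ∀ x : ℝ, 0 ≤ x → 0 ≤ ψ x := fun x hx => by positivity
  have hψm : ∀ x y : ℝ, 0 ≤ x → x ≤ y → ψ x ≤ ψ y := fun x y hx hxy => by
    have := Real.rpow_le_rpow hx hxy hδ.le
    have := Real.rpow_le_rpow hx hxy (by norm_num : (0 : ℝ) ≤ 1 / 2)
    simp only [hψ]
    have hy := hx.trans hxy
    gcongr
  set Φ : ℕ → ℝ := fun d => ((6 * d ^ 2 : ℕ) : ℝ) * ψ ((6 * d ^ 2 : ℕ) : ℝ) with hΦ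
  have hΦ0 : ∀ d, 0 ≤ Φ d := fun d => mul_nonneg (Nat.cast_nonneg _) (hψ0 _ (Nat.cast_nonneg _))
  have hΦadd : ∀ d e, Φ d + Φ e ≤ Φ (d + e) := by
    intro d e
    have h1 : ψ ((6 * d ^ 2 : ℕ) : ℝ) ≤ ψ ((6 * (d + e) ^ 2 : ℕ) : ℝ) :=
      hψm _ _ (Nat.cast_nonneg _) (by exact_mod_cast (by gcongr; omega))
    have h2 : ψ ((6 * e ^ 2 : ℕ) : ℝ) ≤ ψ ((6 * (d + e) ^ 2 : ℕ) : ℝ) :=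
      hψm _ _ (Nat.cast_nonneg _) (by exact_mod_cast (by gcongr; omega))
    have h3 : ((6 * d ^ 2 : ℕ) : ℝ) + ((6 * e ^ 2 : ℕ) : ℝ) ≤ ((6 * (d + e) ^ 2 : ℕ) : ℝ) := by
      exact_mod_cast (by nlinarith [Nat.zero_le (d * e)])
    have h4 := hψ0 ((6 * (d + e) ^ 2 : ℕ) : ℝ) (Nat.cast_nonneg _)
    simp only [hΦ]
    calc _ ≤ ((6 * d ^ 2 : ℕ) : ℝ) * ψ ((6 * (d + e) ^ 2 : ℕ) : ℝ) +
          ((6 * e ^ 2 : ℕ) : ℝ) * ψ ((6 * (d + e) ^ 2 : ℕ) : ℝ) := by gcongr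
      _ ≤ _ := by rw [← add_mul]; gcongr
  induction N using Nat.strong_induction_on with
  | _ N ih =>
  intro hNp L M hL hM hkL hLN hMN
  have hkR : (1 : ℝ) ≤ k := by exact_mod_cast hk
  change _ ≤ N * ψ N
  have hLR : (L.card : ℝ) ≤ N := by exact_mod_cast hLN
  have hMR : (M.card : ℝ) ≤ N := by exact_mod_cast hMN
  have hN0 : (0 : ℝ) ≤ N := Nat.cast_nonneg _
  rcases Nat.eq_zero_or_pos N with rfl | hNpos
  · have := inc_le_mul L M
    have hL0 : L.card = 0 := by omega
    rw [hL0, zero_mul] at this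
    have : inc L M = 0 := by omega
    rw [this]; simp
  have hN1 : (1 : ℝ) ≤ N := by exact_mod_cast hNpos
  have hNδ : (1 : ℝ) ≤ (N : ℝ) ^ δ := Real.one_le_rpow hN1 hδ.le
  have hNh : (1 : ℝ) ≤ (N : ℝ) ^ (1 / 2 : ℝ) := Real.one_le_rpow hN1 (by norm_num)
  rcases lt_or_ge N T with hNT | hNT
  · have h1 : (inc L M : ℝ) ≤ L.card * M.card := by exact_mod_cast inc_le_mul L M
    have hNTR : (N : ℝ) ≤ T := by exact_mod_cast hNT.le
    have h2 : (T : ℝ) ≤ ψ N := by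
      simp only [hψ]
      have : (T : ℝ) * 1 * 1 ≤ 146 * T * (N : ℝ) ^ δ * ((N : ℝ) ^ (1 / 2 : ℝ) + k) := by
        gcongr <;> linarith
      linarith
    calc (inc L M : ℝ) ≤ L.card * M.card := h1
      _ ≤ N * T := by gcongr; linarith
      _ ≤ N * ψ N := by gcongr
  have hNTR : (T : ℝ) ≤ N := by exact_mod_cast hNT
  have hTpos : (0 : ℝ) < T := by linarith
  set n := N / T + 1 with hn
  have hn1 : N ≤ T * n := by
    rw [hn, mul_add, mul_one]
    have := Nat.div_add_mod N T
    have := Nat.mod_lt N (show 0 < T by omega)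
    omega
  have hn2 : n * T ≤ 2 * N := by
    rw [hn, add_mul, one_mul]
    have := Nat.div_mul_le_self N T
    omega
  have hxN : ∀ d : ℕ, d ^ 2 ≤ 27 * n → 6 * d ^ 2 * T ≤ 324 * N := by
    intro d hd
    nlinarith [Nat.mul_le_mul_right T hd]
  have hxN' : ∀ d : ℕ, d ^ 2 ≤ 27 * n → 6 * d ^ 2 < N := by
    intro d hd
    have := hxN d hd
    nlinarith
  have hclass : ∀ L' ⊆ L, L'.card ≤ n → (inc L' M : ℝ) ≤
      N * (k + 72 * (N : ℝ) ^ (1 / 2 : ℝ)) + 324 * N / T * (1 / 648 * ψ N) := by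
    intro L' hL' hc
    have h27 : 27 * n < p ^ 2 := by nlinarith
    obtain ⟨D, hD, hinc⟩ := inc_le_step hΦ0 hΦadd h27 (hL.mono (by exact_mod_cast hL')) hM
      (hkL.mono hL') hc (fun d hd L'' hL'' M'' hM'' h1 h2 => ih (6 * d ^ 2) (hxN' d hd)
        ((Nat.mul_le_mul_left 100 (hxN' d hd).le).trans hNp) L'' M''
        (hL.mono (by exact_mod_cast hL''.trans hL')) (hM.mono (by exact_mod_cast hM''))
        ((hkL.mono hL').mono hL'') h1 h2)
    have hL'N : (L'.card : ℝ) ≤ N := by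
      exact_mod_cast (Finset.card_le_card hL').trans hLN
    have hDN : (D : ℝ) ≤ 8 * (N : ℝ) ^ (1 / 2 : ℝ) := by
      rw [← Real.sqrt_eq_rpow]
      have h1 : D ^ 2 ≤ 64 * N := by
        have := hxN' D hD
        omega
      have h2 : (D : ℝ) ^ 2 ≤ 64 * N := by exact_mod_cast h1
      calc (D : ℝ) ≤ √(64 * N) := Real.le_sqrt_of_sq_le h2
        _ = 8 * √N := by
          rw [Real.sqrt_mul (by norm_num), show (64 : ℝ) = 8 ^ 2 by norm_num,
            Real.sqrt_sq (by norm_num)]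
    have hx : ((6 * D ^ 2 : ℕ) : ℝ) ≤ 324 * N / T := by
      rw [le_div_iff₀ hTpos]; exact_mod_cast hxN D hD
    have hxle : ((6 * D ^ 2 : ℕ) : ℝ) ≤ N := by exact_mod_cast (hxN' D hD).le
    have hψx : ψ ((6 * D ^ 2 : ℕ) : ℝ) ≤ 1 / 648 * ψ N := by
      have h1 : ((6 * D ^ 2 : ℕ) : ℝ) ^ δ ≤ 1 / 648 * (N : ℝ) ^ δ := by
        calc ((6 * D ^ 2 : ℕ) : ℝ) ^ δ ≤ (324 / T * N) ^ δ := by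
              apply Real.rpow_le_rpow (Nat.cast_nonneg _) _ hδ.le
              rw [div_mul_eq_mul_div]; exact hx
          _ = (324 / T : ℝ) ^ δ * (N : ℝ) ^ δ := Real.mul_rpow (by positivity) hN0
          _ ≤ _ := by gcongr
      have h2 : ((6 * D ^ 2 : ℕ) : ℝ) ^ (1 / 2 : ℝ) ≤ (N : ℝ) ^ (1 / 2 : ℝ) :=
        Real.rpow_le_rpow (Nat.cast_nonneg _) hxle (by norm_num)
      simp only [hψ]
      calc _ ≤ 146 * T * (1 / 648 * (N : ℝ) ^ δ) * ((N : ℝ) ^ (1 / 2 : ℝ) + k) := by gcongr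
        _ = _ := by ring
    have hΦD : Φ D ≤ 324 * N / T * (1 / 648 * ψ N) := by
      simp only [hΦ]
      exact mul_le_mul hx hψx (hψ0 _ (Nat.cast_nonneg _)) (by positivity)
    have h1 : 4 * (D : ℝ) * L'.card ≤ 4 * (8 * (N : ℝ) ^ (1 / 2 : ℝ)) * N := by gcongr
    have h2 : 5 * (D : ℝ) * M.card ≤ 5 * (8 * (N : ℝ) ^ (1 / 2 : ℝ)) * N := by gcongr
    have h3 : (k : ℝ) * M.card ≤ k * N := by gcongr
    linarith
  have hmain := inc_le_of_small_subsets T L (hLN.trans hn1) hclass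
  refine hmain.trans ?_
  have h1 : (T : ℝ) * (324 * N / T * (1 / 648 * ψ N)) = N * (ψ N / 2) := by
    field_simp; ring
  rw [mul_add, h1]
  have h2 : (T : ℝ) * (k + 72 * (N : ℝ) ^ (1 / 2 : ℝ)) ≤ ψ N / 2 := by
    simp only [hψ]
    calc (T : ℝ) * (k + 72 * (N : ℝ) ^ (1 / 2 : ℝ))
        ≤ T * 1 * (73 * ((N : ℝ) ^ (1 / 2 : ℝ) + k)) := by
          rw [mul_one]; gcongr; linarith
      _ ≤ T * (N : ℝ) ^ δ * (73 * ((N : ℝ) ^ (1 / 2 : ℝ) + k)) := by gcongr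
      _ = _ := by ring
  calc _ = N * ((T : ℝ) * (k + 72 * (N : ℝ) ^ (1 / 2 : ℝ))) + N * (ψ N / 2) := by ring
    _ ≤ N * (ψ N / 2) + N * (ψ N / 2) := by gcongr
    _ = _ := by ring

end Recursion

section PointPlane
variable {K : Type*} [Field K]

/-- The line associated with a point by the projective change of coordinates with parameter `z`. -/
def toLine (z : K) (x : K × K × K) : K × K × K :=
  ((x.1 + z * x.2.1 + z ^ 2 * x.2.2) / (1 + z ^ 2 * x.2.1), x.2.1 / (1 + z ^ 2 * x.2.1),
    x.2.2 / (1 + z ^ 2 * x.2.1))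

lemma exists_generic [Infinite K] (W : Finset (K × K × K)) :
    ∃ z : K, (∀ x ∈ W, 1 + z ^ 2 * x.2.1 ≠ 0) ∧
      Set.InjOn (fun x => (toLine z x).1) (W : Set (K × K × K)) := by
  classical
  let P : K × K × K → Polynomial K := fun x => 1 + Polynomial.X ^ 2 * Polynomial.C x.2.1
  let N : K × K × K → Polynomial K := fun x =>
    Polynomial.C x.1 + Polynomial.X * Polynomial.C x.2.1 + Polynomial.X ^ 2 * Polynomial.C x.2.2
  have hP : ∀ x, P x ≠ 0 := fun x h => by
    have := congrArg (Polynomial.eval 0) h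
    simp [P] at this
  have hN : ∀ x y, x ≠ y → N x * P y - N y * P x ≠ 0 := by
    intro x y hxy h
    apply hxy
    have e : N x * P y - N y * P x = Polynomial.C (x.1 - y.1) +
        Polynomial.C (x.2.1 - y.2.1) * Polynomial.X ^ 1 +
        Polynomial.C (x.2.2 - y.2.2 + x.1 * y.2.1 - y.1 * x.2.1) * Polynomial.X ^ 2 +
        Polynomial.C (x.2.2 * y.2.1 - y.2.2 * x.2.1) * Polynomial.X ^ 4 := by
      simp only [N, P, map_sub, map_add, map_mul]; ring
    rw [e] at h
    have h0 := congrArg (fun f => Polynomial.coeff f 0) h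
    have h1 := congrArg (fun f => Polynomial.coeff f 1) h
    have h2 := congrArg (fun f => Polynomial.coeff f 2) h
    simp only [Polynomial.coeff_add, Polynomial.coeff_C, Polynomial.coeff_C_mul,
      Polynomial.coeff_X_pow, Polynomial.coeff_zero] at h0 h1 h2
    norm_num at h0 h1 h2
    have h0' := sub_eq_zero.1 h0
    have h1' := sub_eq_zero.1 h1
    refine Prod.ext h0' (Prod.ext h1' ?_)
    rw [h0', h1'] at h2
    linear_combination h2
  have hne : (∏ x ∈ W, P x) * ∏ q ∈ W.offDiag, (N q.1 * P q.2 - N q.2 * P q.1) ≠ 0 :=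
    mul_ne_zero (Finset.prod_ne_zero_iff.2 fun x _ => hP x)
      (Finset.prod_ne_zero_iff.2 fun q hq => hN _ _ (Finset.mem_offDiag.1 hq).2.2)
  obtain ⟨z, hz⟩ : ∃ z, ((∏ x ∈ W, P x) *
      ∏ q ∈ W.offDiag, (N q.1 * P q.2 - N q.2 * P q.1)).eval z ≠ 0 := by
    by_contra! h
    exact hne (Polynomial.funext fun z => by simpa using h z)
  rw [Polynomial.eval_mul, Polynomial.eval_prod, Polynomial.eval_prod] at hz
  have hz1 := Finset.prod_ne_zero_iff.1 (left_ne_zero_of_mul hz)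
  have hz2 := Finset.prod_ne_zero_iff.1 (right_ne_zero_of_mul hz)
  have hz1' : ∀ x ∈ W, 1 + z ^ 2 * x.2.1 ≠ 0 := fun x hx => by
    have := hz1 x hx
    simp only [P, Polynomial.eval_mul, Polynomial.eval_add, Polynomial.eval_C, Polynomial.eval_X,
      Polynomial.eval_pow, Polynomial.eval_one] at this
    exact this
  refine ⟨z, hz1', fun x hx y hy hxy => ?_⟩
  by_contra hne
  apply hz2 (x, y) (Finset.mem_offDiag.2 ⟨hx, hy, hne⟩)
  simp only [toLine] at hxy
  rw [div_eq_div_iff (hz1' x hx) (hz1' y hy)] at hxy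
  simp only [N, P, Polynomial.eval_sub, Polynomial.eval_mul, Polynomial.eval_add,
    Polynomial.eval_C, Polynomial.eval_X, Polynomial.eval_pow, Polynomial.eval_one]
  linear_combination hxy

lemma meets_toLine {z : K} {x y : K × K × K} (hx : 1 + z ^ 2 * x.2.1 ≠ 0)
    (hy : 1 + z ^ 2 * -y.1 ≠ 0) (h : x.1 * y.1 + x.2.1 * y.2.1 + x.2.2 + y.2.2 = 0) :
    Meets (toLine z x) (toLine z (y.2.1, -y.1, -y.2.2)) := by
  simp only [Meets, toLine]
  generalize hu : 1 + z ^ 2 * x.2.1 = u at *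
  generalize hw : 1 + z ^ 2 * -y.1 = w at *
  field_simp
  subst hu hw
  linear_combination h

/-- Points whose lines lie on a common bilinear graph are collinear. -/
lemma collinear_of_bilinear {z e f g h : K} {x₀ x₁ x : K × K × K}
    (h₀ : 1 + z ^ 2 * x₀.2.1 ≠ 0) (h₁ : 1 + z ^ 2 * x₁.2.1 ≠ 0) (hx : 1 + z ^ 2 * x.2.1 ≠ 0)
    (hne : (toLine z x₀).1 ≠ (toLine z x₁).1)
    (b₀ : (toLine z x₀).2.1 = e * (toLine z x₀).1 + g ∧ (toLine z x₀).2.2 = f * (toLine z x₀).1 + h)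
    (b₁ : (toLine z x₁).2.1 = e * (toLine z x₁).1 + g ∧ (toLine z x₁).2.2 = f * (toLine z x₁).1 + h)
    (bx : (toLine z x).2.1 = e * (toLine z x).1 + g ∧ (toLine z x).2.2 = f * (toLine z x).1 + h) :
    ∃ τ : K, x = x₀ + τ • (x₁ - x₀) := by
  have key : ∀ y : K × K × K, 1 + z ^ 2 * y.2.1 ≠ 0 → ∃ m, m ≠ 0 ∧ y.2.1 * m = (toLine z y).2.1 ∧
      y.2.2 * m = (toLine z y).2.2 ∧ (y.1 + z * y.2.1 + z ^ 2 * y.2.2) * m = (toLine z y).1 ∧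
      m + z ^ 2 * (toLine z y).2.1 = 1 := by
    intro y hy
    refine ⟨(1 + z ^ 2 * y.2.1)⁻¹, inv_ne_zero hy, ?_, ?_, ?_, ?_⟩ <;> simp only [toLine] <;>
      field_simp
  obtain ⟨m₀, -, A₀, B₀, E₀, M₀⟩ := key x₀ h₀
  obtain ⟨m₁, -, A₁, B₁, E₁, M₁⟩ := key x₁ h₁
  obtain ⟨m, hm, A, B, E, M⟩ := key x hx
  generalize toLine z x₀ = l₀ at *
  generalize toLine z x₁ = l₁ at *
  generalize toLine z x = l at *
  obtain ⟨b₀, c₀⟩ := b₀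
  obtain ⟨b₁, c₁⟩ := b₁
  obtain ⟨b, c⟩ := bx
  obtain ⟨θ, hθ⟩ : ∃ θ, θ * (l₁.1 - l₀.1) = l.1 - l₀.1 :=
    ⟨(l.1 - l₀.1) / (l₁.1 - l₀.1), div_mul_cancel₀ _ (sub_ne_zero.2 hne.symm)⟩
  have ha : l.2.1 - l₀.2.1 = θ * (l₁.2.1 - l₀.2.1) := by
    rw [b, b₀, b₁]; linear_combination -e * hθ
  have hb : l.2.2 - l₀.2.2 = θ * (l₁.2.2 - l₀.2.2) := by
    rw [c, c₀, c₁]; linear_combination -f * hθ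
  have hmθ : m - m₀ = θ * (m₁ - m₀) := by
    linear_combination M - M₀ - θ * (M₁ - M₀) - z ^ 2 * ha
  have hτ : θ * m₁ / m * m = θ * m₁ := div_mul_cancel₀ _ hm
  generalize θ * m₁ / m = τ at hτ
  refine ⟨τ, ?_⟩
  have e2 : x.2.1 = x₀.2.1 + τ * (x₁.2.1 - x₀.2.1) := by
    apply mul_right_cancel₀ hm
    linear_combination A + ha - θ * A₁ + (θ - 1) * A₀ - x₀.2.1 * hmθ - (x₁.2.1 - x₀.2.1) * hτ
  have e3 : x.2.2 = x₀.2.2 + τ * (x₁.2.2 - x₀.2.2) := by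
    apply mul_right_cancel₀ hm
    linear_combination B + hb - θ * B₁ + (θ - 1) * B₀ - x₀.2.2 * hmθ - (x₁.2.2 - x₀.2.2) * hτ
  have e1 : x.1 = x₀.1 + τ * (x₁.1 - x₀.1) := by
    have : x.1 + z * x.2.1 + z ^ 2 * x.2.2 = x₀.1 + z * x₀.2.1 + z ^ 2 * x₀.2.2 +
        τ * (x₁.1 + z * x₁.2.1 + z ^ 2 * x₁.2.2 - (x₀.1 + z * x₀.2.1 + z ^ 2 * x₀.2.2)) := by
      apply mul_right_cancel₀ hm
      linear_combination E - hθ - θ * E₁ + (θ - 1) * E₀ -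
        (x₀.1 + z * x₀.2.1 + z ^ 2 * x₀.2.2) * hmθ -
        (x₁.1 + z * x₁.2.1 + z ^ 2 * x₁.2.2 - (x₀.1 + z * x₀.2.1 + z ^ 2 * x₀.2.2)) * hτ
    linear_combination this - z * e2 - z ^ 2 * e3
  exact Prod.ext e1 (Prod.ext e2 e3)

open Classical in
/-- A point-plane incidence bound. -/
theorem exists_pointPlane_le {δ : ℝ} (hδ : 0 < δ) : ∃ C : ℝ, 0 < C ∧ ∀ (K : Type*) [Field K]
    [Infinite K] (p : ℕ) [CharP K p] (k : ℕ), 1 ≤ k → ∀ N : ℕ, 100 * N ≤ p ^ 2 →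
    ∀ X Y : Finset (K × K × K), X.card ≤ N → Y.card ≤ N →
    (∀ x₀ v : K × K × K, v ≠ 0 → (X.filter fun x => ∃ τ : K, x = x₀ + τ • v).card ≤ k) →
    (((X ×ˢ Y).filter fun q =>
        q.1.1 * q.2.1 + q.1.2.1 * q.2.2.1 + q.1.2.2 + q.2.2.2 = 0).card : ℝ) ≤
      N * (C * (N : ℝ) ^ δ * ((N : ℝ) ^ (1 / 2 : ℝ) + k)) := by
  obtain ⟨C, hC, hmain⟩ := exists_inc_le hδ
  refine ⟨C, hC, fun K _ _ p _ k hk N hN X Y hX hY hcol => ?_⟩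
  set σ : K × K × K → K × K × K := fun y => (y.2.1, -y.1, -y.2.2) with hσ
  have hσi : Function.Injective σ := by
    rintro ⟨a, b, c⟩ ⟨a', b', c'⟩ h
    simp only [hσ, Prod.mk.injEq, neg_inj] at h ⊢
    tauto
  obtain ⟨z, hz, hinj⟩ := exists_generic (X ∪ Y.image σ)
  have hzX : ∀ x ∈ X, 1 + z ^ 2 * x.2.1 ≠ 0 := fun x hx => hz x (Finset.mem_union_left _ hx)
  have hzY : ∀ y ∈ Y, 1 + z ^ 2 * -y.1 ≠ 0 := fun y hy =>
    hz (σ y) (Finset.mem_union_right _ (Finset.mem_image_of_mem σ hy))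
  have hiX : Set.InjOn (fun x => (toLine z x).1) (X : Set (K × K × K)) :=
    hinj.mono (by exact_mod_cast Finset.subset_union_left)
  have hiY : Set.InjOn (fun x => (toLine z x).1) ((Y.image σ : Finset _) : Set (K × K × K)) :=
    hinj.mono (by exact_mod_cast Finset.subset_union_right)
  have himg : ∀ W : Finset (K × K × K), Set.InjOn (fun x => (toLine z x).1) (W : Set (K × K × K)) →
      Set.InjOn Prod.fst ((W.image (toLine z) : Finset _) : Set (K × K × K)) := by
    intro W hW l hl m hm hlm
    simp only [Finset.coe_image, Set.mem_image] at hl hm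
    obtain ⟨x, hx, rfl⟩ := hl
    obtain ⟨y, hy, rfl⟩ := hm
    rw [hW hx hy hlm]
  have htX : Set.InjOn (toLine z) (X : Set (K × K × K)) := fun x hx y hy h =>
    hiX hx hy (congrArg Prod.fst h)
  have htY : Set.InjOn (toLine z) ((Y.image σ : Finset _) : Set (K × K × K)) := fun x hx y hy h =>
    hiY hx hy (congrArg Prod.fst h)
  have hb : BilinearBound k (X.image (toLine z)) := by
    intro e f g h
    rw [Finset.filter_image, Finset.card_image_of_injOn
      (htX.mono (by exact_mod_cast Finset.filter_subset _ _))]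
    set S := X.filter fun x => (toLine z x).2.1 = e * (toLine z x).1 + g ∧
      (toLine z x).2.2 = f * (toLine z x).1 + h with hS
    rcases Nat.lt_or_ge 1 S.card with h1 | h1
    · obtain ⟨x₀, hx₀, x₁, hx₁, hne⟩ := Finset.one_lt_card.1 h1
      rw [hS, Finset.mem_filter] at hx₀ hx₁
      refine (Finset.card_le_card fun x hx => ?_).trans
        (hcol x₀ (x₁ - x₀) (sub_ne_zero.2 hne.symm))
      rw [hS, Finset.mem_filter] at hx
      exact Finset.mem_filter.2 ⟨hx.1, collinear_of_bilinear (hzX _ hx₀.1) (hzX _ hx₁.1)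
        (hzX _ hx.1) (fun h => hne (hiX hx₀.1 hx₁.1 h)) hx₀.2 hx₁.2 hx.2⟩
    · exact h1.trans hk
  refine le_trans ?_ (hmain K p k hk N hN (X.image (toLine z)) ((Y.image σ).image (toLine z))
    (himg X hiX) (himg _ hiY) hb (Finset.card_image_le.trans hX)
    ((Finset.card_image_le.trans Finset.card_image_le).trans hY))
  norm_cast
  refine Finset.card_le_card_of_injOn (fun q => (toLine z q.1, toLine z (σ q.2))) ?_ ?_
  · intro q hq
    have hq := Finset.mem_filter.1 hq
    have hq1 := Finset.mem_product.1 hq.1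
    refine Finset.mem_filter.2 ⟨Finset.mem_product.2 ⟨Finset.mem_image_of_mem _ hq1.1,
      Finset.mem_image_of_mem _ (Finset.mem_image_of_mem _ hq1.2)⟩, ?_⟩
    exact meets_toLine (hzX _ hq1.1) (hzY _ hq1.2) hq.2
  · intro q hq r hr h
    have hq := Finset.mem_product.1 (Finset.mem_filter.1 hq).1
    have hr := Finset.mem_product.1 (Finset.mem_filter.1 hr).1
    simp only [Prod.mk.injEq] at h
    exact Prod.ext (htX hq.1 hr.1 h.1) (hσi (htY (Finset.mem_image_of_mem _ hq.2)
      (Finset.mem_image_of_mem _ hr.2) h.2))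

end PointPlane

section Energy

/-- The number of solutions of `a² - b² = u - v` with `a, b ∈ A` and `u, v ∈ U`. -/
def energy {p : ℕ} (A U : Finset (ZMod p)) : ℕ :=
  (((A ×ˢ A) ×ˢ (U ×ˢ U)).filter fun q => q.1.1 ^ 2 - q.1.2 ^ 2 = q.2.1 - q.2.2).card

variable {p : ℕ} {K : Type*} [Field K]

/-- The point attached to `(d, c', u)`. -/
def energyPoint (ι : ZMod p →+* K) (q : ZMod p × ZMod p × ZMod p) : K × K × K :=
  (ι q.1, ι q.2.1, ι (q.1 ^ 2 - q.2.1 ^ 2 - q.2.2))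

/-- The plane attached to `(c, d', v)`. -/
def energyPlane (ι : ZMod p →+* K) (q : ZMod p × ZMod p × ZMod p) : K × K × K :=
  (ι (2 * q.1), ι (-2 * q.2.1), ι (q.1 ^ 2 - q.2.1 ^ 2 + q.2.2))

open Classical in
lemma card_energyPoint_filter_le (ι : ZMod p →+* K) (B A U : Finset (ZMod p)) (x₀ v : K × K × K)
    (hv : v ≠ 0) :
    (((B ×ˢ A ×ˢ U).image (energyPoint ι)).filter fun x => ∃ τ : K, x = x₀ + τ • v).card ≤
      max B.card (max A.card U.card) := by
  set S := ((B ×ˢ A ×ˢ U).image (energyPoint ι)).filter fun x => ∃ τ : K, x = x₀ + τ • v with hS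
  have hmem : ∀ x ∈ S, (∃ d ∈ B, ∃ c ∈ A, ∃ u ∈ U, energyPoint ι (d, c, u) = x) ∧
      ∃ τ : K, x = x₀ + τ • v := by
    intro x hx
    rw [hS, Finset.mem_filter, Finset.mem_image] at hx
    obtain ⟨⟨q, hq, rfl⟩, hτ⟩ := hx
    simp only [Finset.mem_product] at hq
    exact ⟨⟨q.1, hq.1, q.2.1, hq.2.1, q.2.2, hq.2.2, rfl⟩, hτ⟩
  have key : ∀ (f : K × K × K → K) (T : Finset (ZMod p)), (∀ x ∈ S, f x ∈ T.image ι) →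
      (∀ τ τ' : K, f (x₀ + τ • v) = f (x₀ + τ' • v) → τ = τ') → S.card ≤ T.card := by
    intro f T h1 h2
    refine (Finset.card_le_card_of_injOn f h1 ?_).trans Finset.card_image_le
    intro x hx y hy hxy
    obtain ⟨-, τ, rfl⟩ := hmem x hx
    obtain ⟨-, τ', rfl⟩ := hmem y hy
    rw [h2 τ τ' hxy]
  by_cases h1 : v.1 = 0
  · by_cases h2 : v.2.1 = 0
    · have h3 : v.2.2 ≠ 0 := fun h => hv (Prod.ext h1 (Prod.ext h2 h))
      refine (key (fun x => x.1 ^ 2 - x.2.1 ^ 2 - x.2.2) U ?_ ?_).trans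
        ((le_max_right _ _).trans (le_max_right _ _))
      · intro x hx
        obtain ⟨⟨d, -, c, -, u, hu, rfl⟩, -⟩ := hmem x hx
        refine Finset.mem_image.2 ⟨u, hu, ?_⟩
        simp only [energyPoint, map_sub, map_pow]; ring
      · intro τ τ' h
        simpa [h1, h2, h3] using h
    · refine (key (fun x => x.2.1) A ?_ ?_).trans ((le_max_left _ _).trans (le_max_right _ _))
      · intro x hx
        obtain ⟨⟨d, -, c, hc, u, -, rfl⟩, -⟩ := hmem x hx
        exact Finset.mem_image_of_mem ι hc
      · intro τ τ' h
        simpa [h2] using h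
  · refine (key (fun x => x.1) B ?_ ?_).trans (le_max_left _ _)
    · intro x hx
      obtain ⟨⟨d, hd, c, -, u, -, rfl⟩, -⟩ := hmem x hx
      exact Finset.mem_image_of_mem ι hd
    · intro τ τ' h
      simpa [h1] using h

open Classical in
lemma card_sq_mul_energy_le [Fact p.Prime] (hp : p ≠ 2) (ι : ZMod p →+* K)
    (A U : Finset (ZMod p)) :
    A.card ^ 2 * energy A U ≤
      (((((A - A) ×ˢ A ×ˢ U).image (energyPoint ι)) ×ˢ
        ((A ×ˢ (A - A) ×ˢ U).image (energyPlane ι))).filter fun q =>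
          q.1.1 * q.2.1 + q.1.2.1 * q.2.2.1 + q.1.2.2 + q.2.2.2 = 0).card := by
  have h2 : (2 : ZMod p) ≠ 0 := by
    intro h
    have : (p : ℕ) ∣ 2 := (ZMod.natCast_eq_zero_iff 2 p).1 (by exact_mod_cast h)
    exact hp ((Nat.prime_dvd_prime_iff_eq (Fact.out : p.Prime) Nat.prime_two).1 this)
  have hι : Function.Injective ι := ι.injective
  rw [energy, sq, ← Finset.card_product, ← Finset.card_product]
  refine Finset.card_le_card_of_injOn (fun r =>
    (energyPoint ι (r.2.1.1 - r.1.1, r.1.2, r.2.2.1),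
      energyPlane ι (r.1.1, r.2.1.2 - r.1.2, r.2.2.2))) ?_ ?_
  · rintro ⟨⟨c, c'⟩, ⟨a, b⟩, u, v⟩ hr
    simp only [Finset.coe_product, Finset.mem_coe, Finset.mem_product, Finset.mem_filter,
      Set.mem_prod] at hr
    obtain ⟨⟨hc, hc'⟩, ⟨⟨ha, hb⟩, hu, hv⟩, h⟩ := hr
    refine Finset.mem_filter.2 ⟨Finset.mem_product.2 ⟨Finset.mem_image_of_mem _ ?_,
      Finset.mem_image_of_mem _ ?_⟩, ?_⟩
    · exact Finset.mem_product.2 ⟨Finset.sub_mem_sub ha hc, Finset.mem_product.2 ⟨hc', hu⟩⟩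
    · exact Finset.mem_product.2 ⟨hc, Finset.mem_product.2 ⟨Finset.sub_mem_sub hb hc', hv⟩⟩
    · simp only [energyPoint, energyPlane, ← map_mul, ← map_add]
      rw [← map_zero ι]
      congr 1
      linear_combination h
  · rintro ⟨⟨c, c'⟩, ⟨a, b⟩, u, v⟩ - ⟨⟨e, e'⟩, ⟨a', b'⟩, u', v'⟩ - h
    simp only [energyPoint, energyPlane, Prod.mk.injEq, hι.eq_iff, neg_mul, neg_inj,
      mul_right_inj' h2] at h
    obtain ⟨⟨h1, rfl, h3⟩, rfl, h5, h6⟩ := h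
    obtain rfl := sub_left_injective h1
    obtain rfl := sub_left_injective h5
    simp only [sub_right_inj, add_right_inj] at h3 h6
    rw [h3, h6]

lemma le_card_sub_self {A : Finset (ZMod p)} (hA : A.Nonempty) : A.card ≤ (A - A).card := by
  obtain ⟨a, ha⟩ := hA
  exact Finset.card_le_card_of_injOn (· - a) (fun x hx => Finset.sub_mem_sub hx ha)
    (sub_left_injective.injOn)

theorem exists_energy_le {δ : ℝ} (hδ : 0 < δ) : ∃ C : ℝ, 0 < C ∧ ∀ (p : ℕ), p.Prime → p ≠ 2 →
    ∀ A U : Finset (ZMod p), A.Nonempty → ∀ N : ℕ, (A - A).card * A.card * U.card = N →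
    100 * N ≤ p ^ 2 →
    (A.card : ℝ) ^ 2 * energy A U ≤
      N * (C * (N : ℝ) ^ δ * ((N : ℝ) ^ (1 / 2 : ℝ) + ((A - A).card + U.card))) := by
  classical
  obtain ⟨C, hC, h⟩ := exists_pointPlane_le hδ
  refine ⟨C, hC, fun p hp hp2 A U hA N hN hNp => ?_⟩
  have : Fact p.Prime := ⟨hp⟩
  have hB := le_card_sub_self hA
  have hA1 := hA.card_pos
  have h1 := h (AlgebraicClosure (ZMod p)) p ((A - A).card + U.card) (by omega) N hNp
    (((A - A) ×ˢ A ×ˢ U).image (energyPoint (algebraMap _ _)))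
    ((A ×ˢ (A - A) ×ˢ U).image (energyPlane (algebraMap _ _)))
    (Finset.card_image_le.trans (by rw [Finset.card_product, Finset.card_product]; lia))
    (Finset.card_image_le.trans (by rw [Finset.card_product, Finset.card_product]; lia))
    (fun x₀ v hv => (card_energyPoint_filter_le _ _ _ _ x₀ v hv).trans (by omega))
  push_cast at h1
  refine le_trans ?_ h1
  exact_mod_cast card_sq_mul_energy_le hp2 _ A U

end Energy

section Counting

lemma card_filter_eq_eq_sum {α β γ : Type*} [Fintype γ] [DecidableEq γ] (S : Finset α)
    (T : Finset β) (f : α → γ) (h : β → γ) :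
    ((S ×ˢ T).filter fun q => f q.1 = h q.2).card =
      ∑ x, (S.filter fun s => f s = x).card * (T.filter fun t => h t = x).card := by
  rw [Finset.card_eq_sum_card_fiberwise (f := fun q => f q.1) (t := Finset.univ)
    (fun _ _ => Finset.mem_coe.2 (Finset.mem_univ _))]
  refine Finset.sum_congr rfl fun x _ => ?_
  rw [← Finset.card_product, Finset.filter_filter]
  congr 1
  ext q
  simp only [Finset.mem_filter, Finset.mem_product]
  constructor
  · rintro ⟨⟨h1, h2⟩, h3, h4⟩
    exact ⟨⟨h1, h4⟩, h2, h3.symm.trans h4⟩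
  · rintro ⟨⟨h1, h2⟩, h3, h4⟩
    exact ⟨⟨h1, h3⟩, h2.trans h4.symm, h2⟩

lemma card_filter_eq_sq_le {α β γ : Type*} [Fintype γ] [DecidableEq γ] (S : Finset α)
    (T : Finset β) (f : α → γ) (h : β → γ) :
    ((S ×ˢ T).filter fun q => f q.1 = h q.2).card ^ 2 ≤
      ((S ×ˢ S).filter fun q => f q.1 = f q.2).card *
        ((T ×ˢ T).filter fun q => h q.1 = h q.2).card := by
  rw [card_filter_eq_eq_sum, card_filter_eq_eq_sum, card_filter_eq_eq_sum]
  simpa only [sq] using Finset.sum_mul_sq_le_sq_mul_sq Finset.univ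
    (fun x => (S.filter fun s => f s = x).card) (fun x => (T.filter fun t => h t = x).card)

variable {p : ℕ} {A : Finset (ZMod p)}

lemma card_sqDiff_le : (sqDiff A).card ≤ A.card ^ 2 := by
  rw [sqDiff, sq]
  exact Finset.card_sub_le.trans (Nat.mul_le_mul Finset.card_image_le Finset.card_image_le)

lemma sqDiff_nonempty (hA : A.Nonempty) : (sqDiff A).Nonempty :=
  have h : (sqSet A).Nonempty := hA.image _
  h.sub h

lemma card_le_two_mul_card_sqDiff [Fact p.Prime] (hA : A.Nonempty) :
    A.card ≤ 2 * (sqDiff A).card := by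
  have h1 : A.card ≤ 2 * (sqSet A).card := by
    refine Finset.card_le_mul_card_image (f := fun a : ZMod p => a ^ 2) A 2 fun y hy => ?_
    obtain ⟨a, -, rfl⟩ := Finset.mem_image.1 hy
    refine (Finset.card_le_card (t := {a, -a}) fun x hx => ?_).trans Finset.card_le_two
    rcases sq_eq_sq_iff_eq_or_eq_neg.1 (Finset.mem_filter.1 hx).2 with h | h <;> simp [h]
  have h2 : (sqSet A).card ≤ (sqDiff A).card := le_card_sub_self (A := sqSet A) (hA.image _)
  omega

/-- A popular difference has many representations `a² - b²` with `a, b ∈ A`. -/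
lemma sq_card_le_of_mem_popular {x : ZMod p} (hx : x ∈ popular A) :
    A.card ^ 2 ≤
      2 * (sqDiff A).card * ((A ×ˢ A).filter fun q => q.1 ^ 2 - q.2 ^ 2 = x).card := by
  have hx := Finset.mem_filter.1 hx
  have h1 : A.card ^ 2 ≤ 2 * (sqDiff A).card * rep A x := by
    have hD : (0 : ℝ) < (sqDiff A).card := by exact_mod_cast Finset.card_pos.2 ⟨x, hx.1⟩
    have := (div_le_iff₀ (by positivity)).1 hx.2
    rw [mul_comm] at this
    exact_mod_cast this
  refine h1.trans (Nat.mul_le_mul_left _ ?_)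
  refine (Finset.card_le_card (t := ((A ×ˢ A).filter fun q => q.1 ^ 2 - q.2 ^ 2 = x).image
    fun q => (q.1 ^ 2, q.2 ^ 2)) fun q hq => ?_).trans Finset.card_image_le
  obtain ⟨hq, hqx⟩ := Finset.mem_filter.1 hq
  obtain ⟨h1, h2⟩ := Finset.mem_product.1 hq
  obtain ⟨a, ha, ha'⟩ := Finset.mem_image.1 h1
  obtain ⟨b, hb, hb'⟩ := Finset.mem_image.1 h2
  exact Finset.mem_image.2 ⟨(a, b), Finset.mem_filter.2 ⟨Finset.mem_product.2 ⟨ha, hb⟩,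
    by simp only [ha', hb', hqx]⟩, Prod.ext ha' hb'⟩

lemma sq_card_mul_card_le {β : Type*} (S : Finset β) (φ : β → ZMod p)
    (hφ : ∀ s ∈ S, φ s ∈ popular A) :
    A.card ^ 2 * S.card ≤ 2 * (sqDiff A).card *
      (((A ×ˢ A) ×ˢ S).filter fun q => q.1.1 ^ 2 - q.1.2 ^ 2 = φ q.2).card := by
  have h : (((A ×ˢ A) ×ˢ S).filter fun q => q.1.1 ^ 2 - q.1.2 ^ 2 = φ q.2).card =
      ∑ s ∈ S, ((A ×ˢ A).filter fun q => q.1 ^ 2 - q.2 ^ 2 = φ s).card := by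
    simp only [Finset.card_filter]
    rw [Finset.sum_product_right]
  rw [h, Finset.mul_sum, mul_comm, ← smul_eq_mul]
  exact Finset.card_nsmul_le_sum _ _ _ fun s hs => sq_card_le_of_mem_popular (hφ s hs)

lemma sq_card_mul_Tw_le (w : ZMod p) :
    A.card ^ 2 * Tw A w ≤ 2 * (sqDiff A).card * energy A (Pw A w) := by
  have h := sq_card_mul_card_le ((Pw A w ×ˢ Pw A w).filter fun q => q.1 - q.2 ∈ popular A)
    (fun q => q.1 - q.2) fun s hs => (Finset.mem_filter.1 hs).2
  refine h.trans (Nat.mul_le_mul_left _ (Finset.card_le_card fun q hq => ?_))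
  simp only [Finset.mem_filter, Finset.mem_product] at hq ⊢
  exact ⟨⟨hq.1.1, hq.1.2.1⟩, hq.2⟩

lemma sq_sum_card_Pw_le [NeZero p] (W : Finset (ZMod p)) :
    (A.card ^ 2 * ∑ w ∈ W, (Pw A w).card) ^ 2 ≤
      (2 * (sqDiff A).card) ^ 2 * (energy A W * energy A (sqDiff A)) := by
  classical
  have h1 : ∑ w ∈ W, (Pw A w).card =
      ((W ×ˢ sqDiff A).filter fun q => q.2 + q.1 ∈ popular A).card := by
    rw [Finset.card_filter, Finset.sum_product]
    refine Finset.sum_congr rfl fun w _ => ?_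
    rw [← Finset.card_filter]
    congr 1
    ext u
    simp only [Pw, Finset.mem_inter, Finset.mem_image, Finset.mem_filter]
    refine and_congr_right fun _ => ⟨?_, fun h => ⟨_, h, by ring⟩⟩
    rintro ⟨x, hx, rfl⟩
    simpa using hx
  have h2 := sq_card_mul_card_le ((W ×ˢ sqDiff A).filter fun q => q.2 + q.1 ∈ popular A)
    (fun q => q.2 + q.1) fun s hs => (Finset.mem_filter.1 hs).2
  have h3 : (((A ×ˢ A) ×ˢ ((W ×ˢ sqDiff A).filter fun q => q.2 + q.1 ∈ popular A)).filter
      fun q => q.1.1 ^ 2 - q.1.2 ^ 2 = q.2.2 + q.2.1).card ≤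
      (((A ×ˢ W) ×ˢ (A ×ˢ sqDiff A)).filter
        fun q => q.1.1 ^ 2 - q.1.2 = q.2.1 ^ 2 + q.2.2).card := by
    refine Finset.card_le_card_of_injOn (fun q => ((q.1.1, q.2.1), (q.1.2, q.2.2))) ?_ ?_
    · rintro ⟨⟨a, b⟩, w, u⟩ hq
      simp only [Finset.coe_filter, Finset.mem_product, Finset.mem_filter, Set.mem_ofPred_eq]
        at hq ⊢
      exact ⟨⟨⟨hq.1.1.1, hq.1.2.1.1⟩, hq.1.1.2, hq.1.2.1.2⟩, by linear_combination hq.2⟩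
    · rintro ⟨⟨a, b⟩, w, u⟩ - ⟨⟨a', b'⟩, w', u'⟩ - h
      simp only [Prod.mk.injEq] at h ⊢
      tauto
  have h4 := card_filter_eq_sq_le (A ×ˢ W) (A ×ˢ sqDiff A) (fun q => q.1 ^ 2 - q.2)
    (fun q => q.1 ^ 2 + q.2)
  have h5 : (((A ×ˢ W) ×ˢ (A ×ˢ W)).filter
      fun q => q.1.1 ^ 2 - q.1.2 = q.2.1 ^ 2 - q.2.2).card ≤ energy A W := by
    refine Finset.card_le_card_of_injOn (fun q => ((q.1.1, q.2.1), (q.1.2, q.2.2))) ?_ ?_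
    · rintro ⟨⟨a, b⟩, w, u⟩ hq
      simp only [Finset.coe_filter, Finset.mem_product, Set.mem_ofPred_eq] at hq ⊢
      exact ⟨⟨⟨hq.1.1.1, hq.1.2.1⟩, hq.1.1.2, hq.1.2.2⟩, by linear_combination hq.2⟩
    · rintro ⟨⟨a, b⟩, w, u⟩ - ⟨⟨a', b'⟩, w', u'⟩ - h
      simp only [Prod.mk.injEq] at h ⊢
      tauto
  have h6 : (((A ×ˢ sqDiff A) ×ˢ (A ×ˢ sqDiff A)).filter
      fun q => q.1.1 ^ 2 + q.1.2 = q.2.1 ^ 2 + q.2.2).card ≤ energy A (sqDiff A) := by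
    refine Finset.card_le_card_of_injOn (fun q => ((q.1.1, q.2.1), (q.2.2, q.1.2))) ?_ ?_
    · rintro ⟨⟨a, b⟩, w, u⟩ hq
      simp only [Finset.coe_filter, Finset.mem_product, Set.mem_ofPred_eq] at hq ⊢
      exact ⟨⟨⟨hq.1.1.1, hq.1.2.1⟩, hq.1.2.2, hq.1.1.2⟩, by linear_combination hq.2⟩
    · rintro ⟨⟨a, b⟩, w, u⟩ - ⟨⟨a', b'⟩, w', u'⟩ - h
      simp only [Prod.mk.injEq] at h ⊢
      tauto
  rw [h1]
  refine (Nat.pow_le_pow_left (h2.trans (Nat.mul_le_mul_left _ h3)) 2).trans ?_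
  rw [mul_pow]
  exact Nat.mul_le_mul_left _ (h4.trans (Nat.mul_le_mul h5 h6))

/-- Dyadic summation of `g ^ (3/2)`. -/
lemma sum_sqrt_pow_le {α : Type*} (D : Finset α) (g : α → ℕ) (J : ℕ) (hJ : ∀ w ∈ D, g w < 2 ^ J)
    (Q : ℝ) (hQ : ∀ t : ℕ, 1 ≤ t → √(t : ℝ) ^ 3 * ((D.filter fun w => t ≤ g w).card : ℝ) ≤ Q) :
    ∑ w ∈ D, √(g w : ℝ) ^ 3 ≤ 3 * J * Q := by
  have h1 : ∀ w ∈ D, √(g w : ℝ) ^ 3 ≤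
      ∑ j ∈ Finset.range J, if 2 ^ j ≤ g w then 3 * √((2 ^ j : ℕ) : ℝ) ^ 3 else 0 := by
    intro w hw
    have hnn : ∀ j ∈ Finset.range J,
        (0 : ℝ) ≤ if 2 ^ j ≤ g w then 3 * √((2 ^ j : ℕ) : ℝ) ^ 3 else 0 := by
      intro j _
      split_ifs <;> positivity
    rcases Nat.eq_zero_or_pos (g w) with h0 | h0
    · simp [h0]
    have hl := Nat.pow_log_le_self 2 h0.ne'
    have hl2 := Nat.lt_pow_succ_log_self (b := 2) (by norm_num) (g w)
    refine le_trans ?_ (Finset.single_le_sum hnn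
      (Finset.mem_range.2 (Nat.log_lt_of_lt_pow h0.ne' (hJ w hw))))
    rw [if_pos hl]
    have h2 : √(g w : ℝ) ≤ √2 * √((2 ^ Nat.log 2 (g w) : ℕ) : ℝ) := by
      rw [← Real.sqrt_mul (by norm_num)]
      apply Real.sqrt_le_sqrt
      rw [pow_succ, mul_comm] at hl2
      exact_mod_cast hl2.le
    have h3 : √2 ^ 3 ≤ 3 := by
      have := Real.sq_sqrt (show (0 : ℝ) ≤ 2 by norm_num)
      nlinarith [Real.sqrt_nonneg 2]
    calc √(g w : ℝ) ^ 3 ≤ (√2 * √((2 ^ Nat.log 2 (g w) : ℕ) : ℝ)) ^ 3 := by gcongr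
      _ ≤ _ := by rw [mul_pow]; gcongr
  refine (Finset.sum_le_sum h1).trans ?_
  rw [Finset.sum_comm]
  calc _ ≤ ∑ j ∈ Finset.range J, 3 * Q := Finset.sum_le_sum fun j _ => by
        rw [← Finset.sum_filter, Finset.sum_const, nsmul_eq_mul]
        have := hQ (2 ^ j) Nat.one_le_two_pow
        linarith
    _ = _ := by rw [Finset.sum_const, Finset.card_range, nsmul_eq_mul]; ring

end Counting

section Assembly

lemma Xsum_le_of_energy_le {p : ℕ} [Fact p.Prime] {A : Finset (ZMod p)} (hA : A.Nonempty)
    {m s k r : ℝ} (hm : 0 < m) (hs : 0 < s) (hk : 0 < k) (hr : 1 ≤ r)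
    (hAs : (A.card : ℝ) = s ^ 4) (hBm : ((A - A).card : ℝ) = m ^ 4 * s ^ 4)
    (hDk : ((sqDiff A).card : ℝ) = k ^ 4 * s ^ 4)
    (hE : ∀ U : Finset (ZMod p), U.card ≤ (sqDiff A).card →
      (energy A U : ℝ) ≤ r ^ 2 * s ^ 4 * (m ^ 6 * √(U.card : ℝ) ^ 3 + m ^ 8 * U.card))
    {J : ℕ} (hJ1 : 1 ≤ J) (hJ : p < 2 ^ J) :
    (Xsum A : ℝ) ≤ 96 * J * r ^ 5 * (m ^ 15 * k ^ 17 * s ^ 7 + m ^ 14 * k ^ 14 * s ^ 6) := by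
  obtain ⟨d, hd⟩ : ∃ d, d = k * s := ⟨_, rfl⟩
  have hd0 : 0 < d := by rw [hd]; positivity
  have hDd : ((sqDiff A).card : ℝ) = d ^ 4 := by rw [hDk, hd]; ring
  have hsq : √((sqDiff A).card : ℝ) = d ^ 2 := by
    rw [hDd, show d ^ 4 = (d ^ 2) ^ 2 by ring, Real.sqrt_sq (by positivity)]
  have hmd : m ^ 2 ≤ 2 * d ^ 2 := by
    have h1 : m ^ 4 * s ^ 4 ≤ s ^ 4 * s ^ 4 := by
      rw [← hBm, ← hAs]
      exact_mod_cast Finset.card_sub_le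
    have h2 : m ^ 4 ≤ s ^ 4 := le_of_mul_le_mul_right h1 (by positivity)
    have h3 : s ^ 4 ≤ 2 * d ^ 4 := by
      rw [← hAs, ← hDd]
      exact_mod_cast card_le_two_mul_card_sqDiff hA
    refine le_of_sq_le_sq ?_ (by positivity)
    nlinarith [pow_pos hd0 4]
  have hED : (energy A (sqDiff A) : ℝ) ≤ 3 * r ^ 2 * s ^ 4 * m ^ 6 * d ^ 6 := by
    refine (hE _ le_rfl).trans ?_
    rw [hsq, hDd]
    have : m ^ 6 * (d ^ 2) ^ 3 + m ^ 8 * d ^ 4 ≤ 3 * (m ^ 6 * d ^ 6) := by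
      have : m ^ 6 * d ^ 4 * m ^ 2 ≤ m ^ 6 * d ^ 4 * (2 * d ^ 2) := by gcongr
      linarith
    calc _ ≤ r ^ 2 * s ^ 4 * (3 * (m ^ 6 * d ^ 6)) := by gcongr
      _ = _ := by ring
  have hsum : ∀ W : Finset (ZMod p),
      (∑ w ∈ W, ((Pw A w).card : ℝ)) ^ 2 * s ^ 8 ≤
        12 * k ^ 8 * r ^ 2 * m ^ 6 * d ^ 6 * s ^ 4 * energy A W := by
    intro W
    have h1 : ((A.card : ℝ) ^ 2 * ∑ w ∈ W, ((Pw A w).card : ℝ)) ^ 2 ≤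
        (2 * ((sqDiff A).card : ℝ)) ^ 2 * (energy A W * energy A (sqDiff A)) := by
      exact_mod_cast sq_sum_card_Pw_le (A := A) W
    rw [hAs, hDk] at h1
    have h2 : (2 * (k ^ 4 * s ^ 4)) ^ 2 * ((energy A W : ℝ) * energy A (sqDiff A)) ≤
        (2 * (k ^ 4 * s ^ 4)) ^ 2 * (energy A W * (3 * r ^ 2 * s ^ 4 * m ^ 6 * d ^ 6)) := by
      gcongr
    refine le_of_mul_le_mul_right ?_ (show 0 < s ^ 8 by positivity)
    linarith
  have hsumD : ∑ w ∈ sqDiff A, ((Pw A w).card : ℝ) ≤ 6 * k ^ 4 * r ^ 2 * m ^ 6 * d ^ 6 := by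
    refine le_of_sq_le_sq (le_of_mul_le_mul_right ((hsum _).trans ?_)
      (show 0 < s ^ 8 by positivity)) (by positivity)
    calc _ ≤ 12 * k ^ 8 * r ^ 2 * m ^ 6 * d ^ 6 * s ^ 4 * (3 * r ^ 2 * s ^ 4 * m ^ 6 * d ^ 6) := by
          gcongr
      _ = _ := by ring
  have hlevel : ∀ t : ℕ, 1 ≤ t →
      √(t : ℝ) ^ 3 * (((sqDiff A).filter fun w => t ≤ (Pw A w).card).card : ℝ) ≤
        16 * k ^ 6 * r ^ 3 * m ^ 9 * d ^ 7 := by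
    intro t _
    set W := (sqDiff A).filter fun w => t ≤ (Pw A w).card with hW
    have hWD : W ⊆ sqDiff A := Finset.filter_subset _ _
    obtain ⟨v, hv⟩ : ∃ v, v = √√(W.card : ℝ) := ⟨_, rfl⟩
    have hv0 : 0 ≤ v := hv ▸ Real.sqrt_nonneg _
    have hv2 : √(W.card : ℝ) = v ^ 2 := by rw [hv, Real.sq_sqrt (Real.sqrt_nonneg _)]
    have hv4 : (W.card : ℝ) = v ^ 4 := by
      rw [show v ^ 4 = (v ^ 2) ^ 2 by ring, ← hv2, Real.sq_sqrt (Nat.cast_nonneg _)]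
    have hvd : v ≤ d := by
      refine le_of_pow_le_pow_left₀ (n := 4) (by norm_num) hd0.le ?_
      rw [← hv4, ← hDd]
      exact_mod_cast Finset.card_le_card hWD
    have ht : (t : ℝ) * v ^ 4 ≤ ∑ w ∈ W, ((Pw A w).card : ℝ) := by
      rw [← hv4, mul_comm, ← nsmul_eq_mul]
      exact Finset.card_nsmul_le_sum _ _ _ fun w hw => by
        exact_mod_cast (Finset.mem_filter.1 hw).2
    have h1 := hsum W
    have hEW := hE W (Finset.card_le_card hWD)
    rw [hv2, hv4] at hEW
    rw [hv4]
    clear_value W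
    rcases hv0.eq_or_lt with h0 | hvpos
    · rw [← h0]; simp; positivity
    have h2 : m ^ 6 * (v ^ 2) ^ 3 + m ^ 8 * v ^ 4 ≤ 3 * m ^ 6 * d ^ 2 * v ^ 4 := by
      have e1 : m ^ 6 * v ^ 4 * m ^ 2 ≤ m ^ 6 * v ^ 4 * (2 * d ^ 2) := by gcongr
      have e2 : m ^ 6 * v ^ 4 * v ^ 2 ≤ m ^ 6 * v ^ 4 * d ^ 2 := by gcongr
      linarith
    have h3 : (t * v ^ 2) ^ 2 ≤ (6 * k ^ 4 * r ^ 2 * m ^ 6 * d ^ 4) ^ 2 := by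
      refine le_of_mul_le_mul_right ?_ (show 0 < v ^ 4 * s ^ 8 by positivity)
      calc _ = ((t : ℝ) * v ^ 4) ^ 2 * s ^ 8 := by ring
        _ ≤ (∑ w ∈ W, ((Pw A w).card : ℝ)) ^ 2 * s ^ 8 := by gcongr
        _ ≤ _ := h1
        _ ≤ 12 * k ^ 8 * r ^ 2 * m ^ 6 * d ^ 6 * s ^ 4 *
            (r ^ 2 * s ^ 4 * (3 * m ^ 6 * d ^ 2 * v ^ 4)) := by
          refine mul_le_mul_of_nonneg_left (hEW.trans ?_) (by positivity)
          gcongr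
        _ = _ := by ring
    have h4 : t * v ^ 2 ≤ 6 * k ^ 4 * r ^ 2 * m ^ 6 * d ^ 4 :=
      le_of_sq_le_sq h3 (by positivity)
    have h5 : √(t : ℝ) * v ≤ 5 / 2 * k ^ 2 * r * m ^ 3 * d ^ 2 := by
      refine le_of_sq_le_sq ?_ (by positivity)
      rw [mul_pow, Real.sq_sqrt (Nat.cast_nonneg _)]
      have : 0 ≤ k ^ 4 * r ^ 2 * m ^ 6 * d ^ 4 := by positivity
      linarith
    calc √(t : ℝ) ^ 3 * v ^ 4 = (√(t : ℝ) * v) ^ 3 * v := by ring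
      _ ≤ (5 / 2 * k ^ 2 * r * m ^ 3 * d ^ 2) ^ 3 * d := by gcongr
      _ = 125 / 8 * (k ^ 6 * r ^ 3 * m ^ 9 * d ^ 7) := by ring
      _ ≤ 16 * (k ^ 6 * r ^ 3 * m ^ 9 * d ^ 7) := by gcongr; norm_num
      _ = _ := by ring
  have hpow := sum_sqrt_pow_le (sqDiff A) (fun w => (Pw A w).card) J
    (fun w _ => lt_of_le_of_lt ((Finset.card_le_univ _).trans (ZMod.card p).le) hJ) _ hlevel
  have hT : ∀ w, (Tw A w : ℝ) ≤
      2 * k ^ 4 * r ^ 2 * (m ^ 6 * √((Pw A w).card : ℝ) ^ 3 + m ^ 8 * (Pw A w).card) := by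
    intro w
    have h1 : (A.card : ℝ) ^ 2 * Tw A w ≤ 2 * (sqDiff A).card * energy A (Pw A w) := by
      exact_mod_cast sq_card_mul_Tw_le w
    rw [hAs, hDk] at h1
    refine le_of_mul_le_mul_left (h1.trans ?_) (show 0 < (s ^ 4) ^ 2 by positivity)
    calc _ ≤ _ := mul_le_mul_of_nonneg_left
          (hE (Pw A w) (Finset.card_le_card Finset.inter_subset_left)) (by positivity)
      _ = _ := by ring
  have hX : (Xsum A : ℝ) ≤ 2 * k ^ 4 * r ^ 2 *
      (m ^ 6 * (3 * J * (16 * k ^ 6 * r ^ 3 * m ^ 9 * d ^ 7)) +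
        m ^ 8 * (6 * k ^ 4 * r ^ 2 * m ^ 6 * d ^ 6)) := by
    rw [Xsum, Nat.cast_sum]
    refine (Finset.sum_le_sum fun w _ => hT w).trans ?_
    rw [← Finset.mul_sum, Finset.sum_add_distrib, ← Finset.mul_sum, ← Finset.mul_sum]
    gcongr
  have hJ1' : (1 : ℝ) ≤ J := by exact_mod_cast hJ1
  have h12 : 12 * r ^ 4 ≤ 96 * J * r ^ 5 := by
    have : r ^ 4 ≤ r ^ 5 := pow_le_pow_right₀ hr (by norm_num)
    nlinarith [show (0 : ℝ) < r ^ 5 by positivity]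
  calc _ ≤ _ := hX
    _ = 96 * J * r ^ 5 * (m ^ 15 * k ^ 17 * s ^ 7) + 12 * r ^ 4 * (m ^ 14 * k ^ 14 * s ^ 6) := by
      rw [hd]; ring
    _ ≤ 96 * J * r ^ 5 * (m ^ 15 * k ^ 17 * s ^ 7) +
        96 * J * r ^ 5 * (m ^ 14 * k ^ 14 * s ^ 6) := by gcongr
    _ = _ := by ring

lemma le_of_sq_mul_le {e n B U c m s : ℝ} (hs : 0 < s) (hm : 1 ≤ m) (hc : 0 ≤ c) (hU : 0 ≤ U)
    (hn : n = s ^ 4) (hB : B = m ^ 4 * s ^ 4) (hUn : U ≤ n ^ 2)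
    (h : n ^ 2 * e ≤ B * n * U * (c * ((B * n * U) ^ (1 / 2 : ℝ) + (B + U)))) :
    e ≤ 2 * c * s ^ 4 * (m ^ 6 * √U ^ 3 + m ^ 8 * U) := by
  obtain ⟨v, hv, rfl⟩ : ∃ v, 0 ≤ v ∧ v ^ 2 = U := ⟨√U, Real.sqrt_nonneg _, Real.sq_sqrt hU⟩
  subst hn hB
  rw [Real.sqrt_sq hv]
  have hvs : v ≤ s ^ 4 := le_of_sq_le_sq hUn (by positivity)
  have hroot : (m ^ 4 * s ^ 4 * s ^ 4 * v ^ 2) ^ (1 / 2 : ℝ) = m ^ 2 * s ^ 4 * v := by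
    rw [← Real.sqrt_eq_rpow, show m ^ 4 * s ^ 4 * s ^ 4 * v ^ 2 = (m ^ 2 * s ^ 4 * v) ^ 2 by ring,
      Real.sqrt_sq (by positivity)]
  rw [hroot] at h
  have h1 : v ^ 2 ≤ m ^ 2 * s ^ 4 * v := by
    have : v * v ≤ s ^ 4 * v := by gcongr
    have : 1 * (s ^ 4 * v) ≤ m ^ 2 * (s ^ 4 * v) := by gcongr; exact one_le_pow₀ hm
    linarith
  have h2 : m ^ 2 * s ^ 4 * v + (m ^ 4 * s ^ 4 + v ^ 2) ≤
      2 * (m ^ 2 * s ^ 4 * v + m ^ 4 * s ^ 4) := by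
    have : 0 ≤ m ^ 4 * s ^ 4 := by positivity
    linarith
  refine le_of_mul_le_mul_left (h.trans ?_) (show 0 < (s ^ 4) ^ 2 by positivity)
  calc _ ≤ m ^ 4 * s ^ 4 * s ^ 4 * v ^ 2 * (c * (2 * (m ^ 2 * s ^ 4 * v + m ^ 4 * s ^ 4))) := by
        gcongr
    _ = _ := by ring

lemma natLog_add_one_le {δ : ℝ} (hδ : 0 < δ) {p : ℕ} (hp : 2 ≤ p) :
    ((Nat.log 2 p + 1 : ℕ) : ℝ) ≤ (1 / (δ * Real.log 2) + 1) * (p : ℝ) ^ δ := by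
  have hp1 : (1 : ℝ) ≤ p := by exact_mod_cast (by omega : 1 ≤ p)
  have h2 : 0 < Real.log 2 := Real.log_pos (by norm_num)
  have h1 : (Nat.log 2 p : ℝ) ≤ (p : ℝ) ^ δ / (δ * Real.log 2) := by
    refine (Real.natLog_le_logb p 2).trans ?_
    rw [Real.logb, ← div_div]
    push_cast
    gcongr
    exact Real.log_le_rpow_div (by positivity) hδ
  have h3 : 1 ≤ (p : ℝ) ^ δ := Real.one_le_rpow hp1 hδ.le
  push_cast
  rw [add_mul, one_div_mul_eq_div]
  linarith

lemma rpow_quarter {x : ℝ} (hx : 0 ≤ x) (j : ℕ) {y : ℝ} (hy : (1 / 4 : ℝ) * j = y) :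
    x ^ y = (x ^ (1 / 4 : ℝ)) ^ j := by
  rw [← hy, Real.rpow_mul_natCast hx]

end Assembly

/-- For every `ε > 0` there exist `C_ε > 0` and `c > 0` such that for every prime `p` and
every nonempty `A ⊆ 𝔽_p` with `|A²-A²|·|A-A|·|A| ≤ c·p²`,
`X ≤ C_ε·p^ε·(M^{15/4}·K^{17/4}·|A|^{7/4} + M^{7/2}·K^{7/2}·|A|^{3/2})`
with `M = |A-A|/|A|`, `K = |A²-A²|/|A|`. -/
theorem Xsum_upper (ε : ℝ) (hε : 0 < ε) :
    ∃ Cε c : ℝ, 0 < Cε ∧ 0 < c ∧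
      ∀ (p : ℕ), p.Prime →
        ∀ A : Finset (ZMod p), A.Nonempty →
          (((sqDiff A).card : ℝ) * ((A - A).card : ℝ) * (A.card : ℝ) ≤ c * (p : ℝ) ^ 2) →
          (Xsum A : ℝ) ≤
            Cε * (p : ℝ) ^ ε *
              ((((A - A).card : ℝ) / (A.card : ℝ)) ^ ((15 : ℝ) / 4)
                  * (((sqDiff A).card : ℝ) / (A.card : ℝ)) ^ ((17 : ℝ) / 4)
                  * (A.card : ℝ) ^ ((7 : ℝ) / 4)
                + (((A - A).card : ℝ) / (A.card : ℝ)) ^ ((7 : ℝ) / 2)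
                  * (((sqDiff A).card : ℝ) / (A.card : ℝ)) ^ ((7 : ℝ) / 2)
                  * (A.card : ℝ) ^ ((3 : ℝ) / 2)) := by
  obtain ⟨δ, hδε⟩ : ∃ δ, δ = ε / 6 := ⟨_, rfl⟩
  have hδ : 0 < δ := by rw [hδε]; positivity
  obtain ⟨C, hC, henergy⟩ := exists_energy_le hδ
  obtain ⟨c₀, hc₀⟩ : ∃ c₀, c₀ = √(max 1 (2 * C)) := ⟨_, rfl⟩
  have hc₀1 : 1 ≤ c₀ := by rw [hc₀, Real.one_le_sqrt]; exact le_max_left _ _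
  have hc₀C : 2 * C ≤ c₀ ^ 2 := by
    rw [hc₀, Real.sq_sqrt (by positivity)]; exact le_max_right _ _
  have hlog : 0 < Real.log 2 := Real.log_pos (by norm_num)
  refine ⟨96 * (1 / (δ * Real.log 2) + 1) * c₀ ^ 5, 1 / 100, by positivity, by norm_num,
    fun p hp A hA hsmall => ?_⟩
  have : Fact p.Prime := ⟨hp⟩
  have hp1 : (1 : ℝ) ≤ p := by exact_mod_cast hp.one_le
  have hn : (0 : ℝ) < A.card := by exact_mod_cast hA.card_pos
  have hB : (A.card : ℝ) ≤ (A - A).card := by exact_mod_cast le_card_sub_self hA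
  have hD : (0 : ℝ) < (sqDiff A).card := by exact_mod_cast (sqDiff_nonempty hA).card_pos
  have hM1 : 1 ≤ ((A - A).card : ℝ) / A.card := (one_le_div hn).2 hB
  have hsmall' : 100 * ((A - A).card * A.card * (sqDiff A).card) ≤ p ^ 2 := by
    have : 100 * (((A - A).card : ℝ) * A.card * (sqDiff A).card) ≤ (p : ℝ) ^ 2 := by linarith
    exact_mod_cast this
  have hp2 : p ≠ 2 := by
    rintro rfl
    have h1 : 0 < (A - A).card * A.card * (sqDiff A).card :=
      Nat.mul_pos (Nat.mul_pos (hA.sub hA).card_pos hA.card_pos) (sqDiff_nonempty hA).card_pos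
    omega
  obtain ⟨M, hM⟩ : ∃ M, M = ((A - A).card : ℝ) / A.card := ⟨_, rfl⟩
  obtain ⟨K, hK⟩ : ∃ K, K = ((sqDiff A).card : ℝ) / A.card := ⟨_, rfl⟩
  have hM0 : 1 ≤ M := hM ▸ hM1
  have hK0 : 0 < K := by rw [hK]; positivity
  have hfour : ∀ x : ℝ, 0 ≤ x → (x ^ (1 / 4 : ℝ)) ^ 4 = x := fun x hx => by
    rw [← rpow_quarter hx 4 (y := 1) (by norm_num), Real.rpow_one]
  have hr2 : (c₀ * (p : ℝ) ^ δ) ^ 2 = c₀ ^ 2 * (p : ℝ) ^ (2 * δ) := by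
    rw [mul_pow, ← Real.rpow_mul_natCast (by positivity)]; norm_num [mul_comm]
  have hmain := Xsum_le_of_energy_le hA (m := M ^ (1 / 4 : ℝ)) (s := (A.card : ℝ) ^ (1 / 4 : ℝ))
    (k := K ^ (1 / 4 : ℝ)) (r := c₀ * (p : ℝ) ^ δ) (by positivity) (by positivity) (by positivity)
    (one_le_mul_of_one_le_of_one_le hc₀1 (Real.one_le_rpow hp1 hδ.le))
    (hfour _ hn.le).symm
    (by rw [hfour _ (by positivity), hfour _ hn.le, hM, div_mul_cancel₀ _ hn.ne'])
    (by rw [hfour _ hK0.le, hfour _ hn.le, hK, div_mul_cancel₀ _ hn.ne']) ?_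
    (J := Nat.log 2 p + 1) (by omega) (Nat.lt_pow_succ_log_self (by norm_num) p)
  · rw [← hM, ← hK, rpow_quarter (by positivity : 0 ≤ M) 15 (y := 15 / 4) (by norm_num),
      rpow_quarter hK0.le 17 (y := 17 / 4) (by norm_num),
      rpow_quarter hn.le 7 (y := 7 / 4) (by norm_num),
      rpow_quarter (by positivity : 0 ≤ M) 14 (y := 7 / 2) (by norm_num),
      rpow_quarter hK0.le 14 (y := 7 / 2) (by norm_num),
      rpow_quarter hn.le 6 (y := 3 / 2) (by norm_num)]
    refine hmain.trans (mul_le_mul_of_nonneg_right ?_ (by positivity))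
    have hpow : (p : ℝ) ^ ε = (p : ℝ) ^ δ * ((p : ℝ) ^ δ) ^ 5 := by
      rw [← Real.rpow_mul_natCast (by positivity), ← Real.rpow_add (by positivity), hδε]
      congr 1; push_cast; ring
    calc _ ≤ 96 * ((1 / (δ * Real.log 2) + 1) * (p : ℝ) ^ δ) * (c₀ * (p : ℝ) ^ δ) ^ 5 := by
          gcongr
          exact natLog_add_one_le hδ hp.two_le
      _ = _ := by rw [hpow]; ring
  · intro U hU
    have hN : (A - A).card * A.card * U.card ≤ (A - A).card * A.card * (sqDiff A).card :=
      Nat.mul_le_mul_left _ hU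
    have h1 := henergy p hp hp2 A U hA _ rfl (le_trans (Nat.mul_le_mul_left _ hN) hsmall')
    have hN2 : (((A - A).card * A.card * U.card : ℕ) : ℝ) ^ δ ≤ (p : ℝ) ^ (2 * δ) := by
      rw [Real.rpow_mul (by positivity)]
      refine Real.rpow_le_rpow (by positivity) ?_ hδ.le
      rw [Real.rpow_two]
      exact_mod_cast (by omega : (A - A).card * A.card * U.card ≤ p ^ 2)
    have h2 : (A.card : ℝ) ^ 2 * energy A U ≤ ((A - A).card : ℝ) * A.card * U.card *
        (C * (p : ℝ) ^ (2 * δ) * ((((A - A).card : ℝ) * A.card * U.card) ^ (1 / 2 : ℝ) +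
          ((A - A).card + U.card))) := by
      refine h1.trans ?_
      push_cast at hN2 ⊢
      gcongr
    have h3 := le_of_sq_mul_le (s := (A.card : ℝ) ^ (1 / 4 : ℝ)) (m := M ^ (1 / 4 : ℝ))
      (by positivity) (Real.one_le_rpow hM0 (by norm_num)) (by positivity) (by positivity)
      (hfour _ hn.le).symm
      (by rw [hfour _ (by positivity), hfour _ hn.le, hM, div_mul_cancel₀ _ hn.ne'])
      (by exact_mod_cast hU.trans card_sqDiff_le) h2
    refine h3.trans ?_
    rw [hr2, ← mul_assoc 2 C]
    gcongr

end FpSumProd
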